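/- arXiv:2007.10622 — 3 statements merged into one kernel-verified Lean document; each statement's English description precedes it below -/
import Mathlib

section
/- There is a universal constant C > 0 such that for all integers n, T ≥ 2 and every probability distribution p on ℝ^n supported on the closed Euclidean unit ball, there exists an online signing algorithm (a family of measurable maps χ_t : (ℝ^n)^t × [0,1]^t → {−1,+1}, t = 1,…,T) such that, when v_1,…,v_T are i.i.d. with law p and u_1,…,u_T are independent i.i.d. seeds uniform on [0,1], with probability at least 1 − C/T the discrepancy vectors d_t = Σ_{s=1}^t χ_s(v_1,…,v_s,u_1,…,u_s)·v_s satisfy ‖d_t‖_∞ ≤ C·(log(nT))^4 for every t ∈ {1,…,T}. -/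
open MeasureTheory Real

namespace SelfBalancingWalk

open ProbabilityTheory

variable {ι : Type*} [Fintype ι]

/-- The uniform distribution on `[0, 1]`. -/
noncomputable abbrev unitUniform : Measure ℝ := volume.restrict (Set.Icc (0 : ℝ) 1)

instance : IsProbabilityMeasure unitUniform := ⟨by simp⟩

/-- The sign chosen at position `w` for the vector `x` with seed `r`; for a uniform seed its mean
is `-(w ⬝ᵥ x) / c` as long as `|w ⬝ᵥ x| ≤ c`. -/
noncomputable def stepSign (c : ℝ) (w x : ι → ℝ) (r : ℝ) : ℝ :=
  if r ≤ (1 - (w ⬝ᵥ x) / c) / 2 then 1 else -1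

/-- The self-balancing walk of Alweiss, Liu and Sawhney. -/
noncomputable def walk (c : ℝ) (v : ℕ → ι → ℝ) (u : ℕ → ℝ) : ℕ → ι → ℝ
  | 0 => 0
  | t + 1 => walk c v u t + stepSign c (walk c v u t) (v t) (u t) • v t

/-- The walk has not left the range where its signs are unclamped before time `t`. -/
def Good (c : ℝ) (v : ℕ → ι → ℝ) (u : ℕ → ℝ) (t : ℕ) : Prop :=
  ∀ s < t, |walk c v u s ⬝ᵥ v s| ≤ c

/-- Extension of a finite sequence by zero. -/
def extendZero {α : Type*} [Zero α] {m : ℕ} (a : Fin m → α) (k : ℕ) : α :=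
  if h : k < m then a ⟨k, h⟩ else 0

lemma stepSign_eq_or (c : ℝ) (w x : ι → ℝ) (r : ℝ) :
    stepSign c w x r = 1 ∨ stepSign c w x r = -1 := by
  unfold stepSign; split_ifs <;> simp

lemma measurable_stepSign {Ω : Type*} [MeasurableSpace Ω] (c : ℝ) {W X : Ω → ι → ℝ} {R : Ω → ℝ}
    (hW : Measurable W) (hX : Measurable X) (hR : Measurable R) :
    Measurable fun q => stepSign c (W q) (X q) (R q) := by
  unfold stepSign dotProduct
  refine Measurable.ite (measurableSet_le hR ?_) measurable_const measurable_const
  fun_prop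

lemma measurable_walk {Ω : Type*} [MeasurableSpace Ω] (c : ℝ) {V : Ω → ℕ → ι → ℝ} {U : Ω → ℕ → ℝ}
    (hV : ∀ k, Measurable fun q => V q k) (hU : ∀ k, Measurable fun q => U q k) (t : ℕ) :
    Measurable fun q => walk c (V q) (U q) t := by
  induction t with
  | zero => exact measurable_const
  | succ t ih => exact ih.add ((measurable_stepSign c ih (hV t) (hU t)).smul (hV t))

lemma measurable_extendZero {α : Type*} [Zero α] [MeasurableSpace α] {m : ℕ} (k : ℕ) :
    Measurable fun a : Fin m → α => extendZero a k := by
  unfold extendZero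
  split_ifs <;> fun_prop

lemma walk_congr (c : ℝ) {v v' : ℕ → ι → ℝ} {u u' : ℕ → ℝ} {t : ℕ}
    (hv : ∀ k < t, v k = v' k) (hu : ∀ k < t, u k = u' k) :
    walk c v u t = walk c v' u' t := by
  induction t with
  | zero => rfl
  | succ t ih =>
    simp only [walk, ih (fun k hk => hv k (by omega)) (fun k hk => hu k (by omega)),
      hv t (by omega), hu t (by omega)]

lemma good_congr (c : ℝ) (v : ℕ → ι → ℝ) {u u' : ℕ → ℝ} {t : ℕ}
    (hu : ∀ k, k + 1 < t → u k = u' k) : Good c v u t ↔ Good c v u' t := by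
  refine forall₂_congr fun s hs => ?_
  rw [walk_congr c (fun _ _ => rfl) fun k hk => hu k (by omega)]

lemma walk_eq_sum (c : ℝ) (v : ℕ → ι → ℝ) (u : ℕ → ℝ) (t : ℕ) :
    walk c v u t = ∑ s ∈ Finset.range t, stepSign c (walk c v u s) (v s) (u s) • v s := by
  induction t with
  | zero => rfl
  | succ t ih => rw [Finset.sum_range_succ, ← ih]; rfl

lemma measurable_dotProduct_walk (c : ℝ) (v : ℕ → ι → ℝ) (T t : ℕ) (θ : ι → ℝ) :
    Measurable fun u : Fin T → ℝ => θ ⬝ᵥ walk c v (extendZero u) t := by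
  have := measurable_walk c (V := fun _ : Fin T → ℝ => v) (fun _ => measurable_const)
    measurable_extendZero t
  unfold dotProduct
  fun_prop

lemma measurableSet_good (c : ℝ) (v : ℕ → ι → ℝ) (T t : ℕ) :
    MeasurableSet {u : Fin T → ℝ | Good c v (extendZero u) t} := by
  simp only [Good, Set.ofPred_forall]
  refine MeasurableSet.iInter fun s => MeasurableSet.iInter fun _ => ?_
  simp_rw [dotProduct_comm _ (v s)]
  exact measurableSet_le (measurable_dotProduct_walk c v T s (v s)).abs measurable_const

lemma integral_stepSign {c : ℝ} (hc : 0 < c) {w x : ι → ℝ} (h : |w ⬝ᵥ x| ≤ c) :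
    ∫ r, stepSign c w x r ∂unitUniform = -(w ⬝ᵥ x) / c := by
  obtain ⟨h1, h2⟩ := abs_le.1 h
  have h3 : (w ⬝ᵥ x) / c ≤ 1 := (div_le_one hc).2 h2
  have h4 : -1 ≤ (w ⬝ᵥ x) / c := by rw [le_div_iff₀ hc]; linarith
  set m := (w ⬝ᵥ x) / c with hm
  have hfun : stepSign c w x = fun r =>
      (Set.Iic ((1 - m) / 2)).indicator (fun _ => (2 : ℝ)) r - 1 := by
    funext r
    by_cases hr : r ≤ (1 - m) / 2
    · simp [stepSign, ← hm, hr]; norm_num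
    · simp [stepSign, ← hm, hr]
  have hinter : Set.Iic ((1 - m) / 2) ∩ Set.Icc (0 : ℝ) 1 = Set.Icc 0 ((1 - m) / 2) := by
    ext r; simp only [Set.mem_inter_iff, Set.mem_Iic, Set.mem_Icc]
    constructor
    · rintro ⟨a, b, _⟩; exact ⟨b, a⟩
    · rintro ⟨a, b⟩; exact ⟨b, a, by linarith⟩
  rw [hfun, integral_sub ((integrable_const _).indicator measurableSet_Iic) (integrable_const _),
    integral_indicator_const _ measurableSet_Iic, measureReal_restrict_apply measurableSet_Iic,
    hinter, neg_div, ← hm]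
  simp only [volume_real_Icc, integral_const, smul_eq_mul, probReal_univ]
  rw [max_eq_left (by linarith)]; ring

/-- Hoeffding's lemma for a single step of the walk. -/
lemma lintegral_exp_stepSign_le {c : ℝ} (hc : 0 < c) {w x : ι → ℝ} (h : |w ⬝ᵥ x| ≤ c) (a : ℝ) :
    ∫⁻ r, ENNReal.ofReal (exp (a * stepSign c w x r)) ∂unitUniform ≤
      ENNReal.ofReal (exp (-a * (w ⬝ᵥ x) / c + a ^ 2 / 2)) := by
  have hmeas : Measurable (stepSign c w x) :=
    measurable_stepSign c measurable_const measurable_const measurable_id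
  have hmem : ∀ r, stepSign c w x r ∈ Set.Icc (-1 : ℝ) 1 := fun r => by
    rcases stepSign_eq_or c w x r with h | h <;> simp [h]
  have hsub := hasSubgaussianMGF_of_mem_Icc (μ := unitUniform) hmeas.aemeasurable
    (Filter.Eventually.of_forall hmem)
  have hle := hsub.mgf_le a
  have hint := hsub.integrable_exp_mul a
  rw [integral_stepSign hc h] at hle hint
  have hsplit : ∀ r, exp (a * stepSign c w x r) =
      exp (-a * (w ⬝ᵥ x) / c) * exp (a * (stepSign c w x r - -(w ⬝ᵥ x) / c)) := fun r => by
    rw [← exp_add]; congr 1; ring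
  simp_rw [hsplit]
  rw [← ofReal_integral_eq_lintegral_ofReal (hint.const_mul _)
    (Filter.Eventually.of_forall fun r => by positivity), integral_const_mul, exp_add]
  refine ENNReal.ofReal_le_ofReal (mul_le_mul_of_nonneg_left (hle.trans_eq ?_) (exp_pos _).le)
  congr 1
  norm_num

/-- Resampling one coordinate of a product of probability measures. -/
lemma lintegral_pi_eq_lintegral_update {κ : Type*} [Fintype κ] [DecidableEq κ] {X : κ → Type*}
    [∀ i, MeasurableSpace (X i)] (μ : ∀ i, Measure (X i)) [∀ i, IsProbabilityMeasure (μ i)]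
    {f : (∀ i, X i) → ENNReal} (hf : Measurable f) (i : κ) :
    ∫⁻ x, f x ∂Measure.pi μ = ∫⁻ x, ∫⁻ y, f (Function.update x i y) ∂μ i ∂Measure.pi μ := by
  rcases isEmpty_or_nonempty (∀ i, X i) with hX | ⟨⟨x₀⟩⟩
  · simp [Measure.eq_zero_of_isEmpty]
  have hg : Measurable fun x => ∫⁻ y, f (Function.update x i y) ∂μ i := by
    simpa only [lmarginal_singleton] using hf.lmarginal μ (s := {i})
  rw [lintegral_eq_lmarginal_univ x₀, lintegral_eq_lmarginal_univ x₀,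
    lmarginal_erase' _ hf (Finset.mem_univ i), lmarginal_erase' _ hg (Finset.mem_univ i)]
  simp

lemma extendZero_update {α : Type*} [Zero α] {T t : ℕ} (ht : t < T) (u : Fin T → α) (y : α) :
    extendZero (Function.update u ⟨t, ht⟩ y) = Function.update (extendZero u) t y := by
  funext k
  unfold extendZero
  by_cases hk : k = t
  · subst hk; simp [ht]
  · by_cases hkT : k < T <;> simp [hk, hkT, Function.update, Fin.ext_iff]

/-- On the event `Good`, the walk is subgaussian with variance proxy `c`. -/
lemma lintegral_exp_walk_le {c : ℝ} (hc : 1 ≤ c) {T : ℕ} {v : ℕ → ι → ℝ}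
    (hv : ∀ k, v k ⬝ᵥ v k ≤ 1) {t : ℕ} (ht : t ≤ T) (θ : ι → ℝ) :
    ∫⁻ u, {u : Fin T → ℝ | Good c v (extendZero u) t}.indicator
        (fun u => ENNReal.ofReal (exp (θ ⬝ᵥ walk c v (extendZero u) t))) u
      ∂(Measure.pi fun _ => unitUniform) ≤ ENNReal.ofReal (exp (c / 2 * (θ ⬝ᵥ θ))) := by
  classical
  have hc0 : 0 < c := by linarith
  have hmeas : ∀ s, ∀ θ : ι → ℝ, Measurable fun u : Fin T → ℝ =>
      ENNReal.ofReal (exp (θ ⬝ᵥ walk c v (extendZero u) s)) := fun s θ =>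
    (measurable_dotProduct_walk c v T s θ).exp.ennreal_ofReal
  induction t generalizing θ with
  | zero =>
    simp only [Good, walk, dotProduct_zero, exp_zero, not_lt_zero, IsEmpty.forall_iff,
      implies_true, Set.ofPred_true, Set.indicator_univ, lintegral_const, measure_univ, mul_one]
    refine ENNReal.ofReal_le_ofReal (one_le_exp (mul_nonneg (by linarith) ?_))
    exact Finset.sum_nonneg fun i _ => mul_self_nonneg _
  | succ t ih =>
    set a := θ ⬝ᵥ v t with ha
    rw [lintegral_pi_eq_lintegral_update _
      ((hmeas (t + 1) θ).indicator (measurableSet_good c v T (t + 1))) ⟨t, ht⟩]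
    have hstep : ∀ u : Fin T → ℝ,
        ∫⁻ y, {u : Fin T → ℝ | Good c v (extendZero u) (t + 1)}.indicator
          (fun u => ENNReal.ofReal (exp (θ ⬝ᵥ walk c v (extendZero u) (t + 1))))
          (Function.update u ⟨t, ht⟩ y) ∂unitUniform ≤
        ENNReal.ofReal (exp (a ^ 2 / 2)) * {u : Fin T → ℝ | Good c v (extendZero u) t}.indicator
          (fun u => ENNReal.ofReal (exp ((θ - (a / c) • v t) ⬝ᵥ walk c v (extendZero u) t))) u := by
      intro u
      have hwalk : ∀ y, walk c v (Function.update (extendZero u) t y) t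
          = walk c v (extendZero u) t := fun y =>
        walk_congr c (fun _ _ => rfl) fun k hk => Function.update_of_ne hk.ne _ _
      have hgood : ∀ y, Good c v (Function.update (extendZero u) t y) (t + 1)
          ↔ Good c v (extendZero u) (t + 1) := fun y =>
        good_congr c v fun k hk => Function.update_of_ne (by omega) _ _
      simp only [Set.indicator_apply, Set.mem_ofPred_eq, extendZero_update, hgood]
      by_cases hG : Good c v (extendZero u) (t + 1)
      · have hG' : Good c v (extendZero u) t := fun s hs => hG s (by omega)
        simp only [hG, hG', if_true, walk, hwalk, Function.update_self]
        set w := walk c v (extendZero u) t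
        have hexp : ∀ y, ENNReal.ofReal (exp (θ ⬝ᵥ (w + stepSign c w (v t) y • v t))) =
            ENNReal.ofReal (exp (θ ⬝ᵥ w)) * ENNReal.ofReal (exp (a * stepSign c w (v t) y)) := by
          intro y
          rw [← ENNReal.ofReal_mul (exp_pos _).le, ← exp_add, dotProduct_add, dotProduct_smul,
            ← ha, smul_eq_mul, mul_comm a]
        simp_rw [hexp]
        rw [lintegral_const_mul' _ _ ENNReal.ofReal_ne_top]
        refine (mul_le_mul_right (lintegral_exp_stepSign_le hc0 (hG t (by omega)) a) _).trans_eq ?_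
        rw [← ENNReal.ofReal_mul (exp_pos _).le, ← ENNReal.ofReal_mul (exp_pos _).le, ← exp_add,
          ← exp_add, sub_dotProduct, smul_dotProduct, smul_eq_mul, dotProduct_comm (v t)]
        congr 2
        ring
      · simp [hG]
    refine (lintegral_mono hstep).trans ?_
    rw [lintegral_const_mul' _ _ ENNReal.ofReal_ne_top]
    refine (mul_le_mul_right (ih (by omega) (θ - (a / c) • v t)) _).trans ?_
    rw [← ENNReal.ofReal_mul (exp_pos _).le, ← exp_add]
    refine ENNReal.ofReal_le_ofReal (exp_le_exp.2 ?_)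
    have hnorm : (θ - (a / c) • v t) ⬝ᵥ (θ - (a / c) • v t) =
        θ ⬝ᵥ θ - 2 * a ^ 2 / c + a ^ 2 / c ^ 2 * (v t ⬝ᵥ v t) := by
      simp only [sub_dotProduct, dotProduct_sub, smul_dotProduct, dotProduct_smul, smul_eq_mul,
        dotProduct_comm (v t) θ, ← ha]
      field_simp
      ring
    have hcancel : c / 2 * (θ ⬝ᵥ θ - 2 * a ^ 2 / c + a ^ 2 / c ^ 2 * (v t ⬝ᵥ v t)) =
        c / 2 * (θ ⬝ᵥ θ) - a ^ 2 + a ^ 2 / 2 * ((v t ⬝ᵥ v t) / c) := by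
      field_simp
    have hvc : (v t ⬝ᵥ v t) / c ≤ 1 := (div_le_one hc0).2 ((hv t).trans hc)
    rw [hnorm, hcancel]
    nlinarith [mul_le_mul_of_nonneg_left hvc (by positivity : 0 ≤ a ^ 2 / 2)]

lemma measure_walk_dotProduct_gt_le {c : ℝ} (hc : 1 ≤ c) {T : ℕ} {v : ℕ → ι → ℝ}
    (hv : ∀ k, v k ⬝ᵥ v k ≤ 1) {t : ℕ} (ht : t ≤ T) {x : ι → ℝ} (hx : x ⬝ᵥ x ≤ 1) :
    (Measure.pi fun _ : Fin T => unitUniform)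
        {u | Good c v (extendZero u) t ∧ c < x ⬝ᵥ walk c v (extendZero u) t} ≤
      ENNReal.ofReal (exp (-c / 2)) := by
  classical
  have hmarkov : ENNReal.ofReal (exp c) * (Measure.pi fun _ : Fin T => unitUniform)
      {u | Good c v (extendZero u) t ∧ c < x ⬝ᵥ walk c v (extendZero u) t} ≤
      ENNReal.ofReal (exp (c / 2)) := by
    refine (mul_le_mul_right (measure_mono ?_) _).trans
      ((mul_meas_ge_le_lintegral₀ (AEMeasurable.indicator ?_ (measurableSet_good c v T t)) _).trans
        ((lintegral_exp_walk_le hc hv ht x).trans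
          (ENNReal.ofReal_le_ofReal (exp_le_exp.2 (by nlinarith)))))
    · rintro u ⟨hG, hu⟩
      simp only [Set.mem_ofPred_eq, Set.indicator_apply, hG, if_true]
      exact ENNReal.ofReal_le_ofReal (exp_le_exp.2 hu.le)
    · exact (measurable_dotProduct_walk c v T t x).exp.ennreal_ofReal.aemeasurable
  rw [← ENNReal.mul_le_mul_iff_right (a := ENNReal.ofReal (exp c)) (by simp [exp_pos])
    ENNReal.ofReal_ne_top]
  refine hmarkov.trans_eq ?_
  rw [← ENNReal.ofReal_mul (exp_pos _).le, ← exp_add]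
  congr 2
  ring

lemma measure_abs_walk_dotProduct_gt_le {c : ℝ} (hc : 1 ≤ c) {T : ℕ} {v : ℕ → ι → ℝ}
    (hv : ∀ k, v k ⬝ᵥ v k ≤ 1) {t : ℕ} (ht : t ≤ T) {x : ι → ℝ} (hx : x ⬝ᵥ x ≤ 1) :
    (Measure.pi fun _ : Fin T => unitUniform)
        {u | Good c v (extendZero u) t ∧ c < |walk c v (extendZero u) t ⬝ᵥ x|} ≤
      ENNReal.ofReal (2 * exp (-c / 2)) := by
  rw [two_mul, ENNReal.ofReal_add (exp_pos _).le (exp_pos _).le]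
  refine (measure_mono ?_).trans ((measure_union_le _ _).trans
    (add_le_add (measure_walk_dotProduct_gt_le hc hv ht hx)
      (measure_walk_dotProduct_gt_le hc hv ht (x := -x) (by simpa using hx))))
  rintro u ⟨hG, hu⟩
  rw [dotProduct_comm] at hu
  rcases lt_abs.1 hu with h | h
  · exact Or.inl ⟨hG, h⟩
  · exact Or.inr ⟨hG, by rwa [neg_dotProduct]⟩

lemma measure_exists_walk_gt_le {c : ℝ} (hc : 1 ≤ c) {T : ℕ} {v : ℕ → ι → ℝ}
    (hv : ∀ k, v k ⬝ᵥ v k ≤ 1) :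
    (Measure.pi fun _ : Fin T => unitUniform)
        {u | ∃ t : Fin T, ∃ i, c < |walk c v (extendZero u) (t + 1) i|} ≤
      ENNReal.ofReal ((T + T * Fintype.card ι) * (2 * exp (-c / 2))) := by
  classical
  set μ := Measure.pi fun _ : Fin T => unitUniform
  set A : Fin T → Set (Fin T → ℝ) := fun t =>
    {u | Good c v (extendZero u) t ∧ c < |walk c v (extendZero u) t ⬝ᵥ v t|}
  set B : Fin T × ι → Set (Fin T → ℝ) := fun q =>
    {u | Good c v (extendZero u) (q.1 + 1) ∧
      c < |walk c v (extendZero u) (q.1 + 1) ⬝ᵥ Pi.single q.2 1|}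
  have hsub : {u : Fin T → ℝ | ∃ t : Fin T, ∃ i, c < |walk c v (extendZero u) (t + 1) i|} ⊆
      (⋃ t, A t) ∪ ⋃ q, B q := by
    rintro u ⟨t, i, hu⟩
    by_contra hnot
    simp only [Set.mem_union, Set.mem_iUnion, not_or, not_exists, A, B, Set.mem_ofPred_eq,
      not_and, not_lt] at hnot
    have hgood : ∀ s ≤ T, Good c v (extendZero u) s := by
      intro s
      induction s with
      | zero => intro _ r hr; omega
      | succ s ih =>
        intro hs r hr
        rcases Nat.lt_succ_iff_lt_or_eq.1 hr with h | rfl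
        · exact ih (by omega) r h
        · exact hnot.1 ⟨r, hs⟩ (ih (by omega))
    have := hnot.2 (t, i) (hgood _ t.isLt)
    simp only [dotProduct_single, mul_one] at this
    linarith
  have hA : ∀ t, μ (A t) ≤ ENNReal.ofReal (2 * exp (-c / 2)) := fun t =>
    measure_abs_walk_dotProduct_gt_le hc hv t.isLt.le (hv t)
  have hB : ∀ q, μ (B q) ≤ ENNReal.ofReal (2 * exp (-c / 2)) := fun q =>
    measure_abs_walk_dotProduct_gt_le hc hv q.1.isLt (by simp)
  calc μ _ ≤ ∑ t, μ (A t) + ∑ q, μ (B q) :=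
        (measure_mono hsub).trans ((measure_union_le _ _).trans
          (add_le_add (measure_iUnion_fintype_le _ _) (measure_iUnion_fintype_le _ _)))
    _ ≤ ∑ _ : Fin T, ENNReal.ofReal (2 * exp (-c / 2)) +
          ∑ _ : Fin T × ι, ENNReal.ofReal (2 * exp (-c / 2)) := by
        gcongr with t _ q _
        · exact hA t
        · exact hB q
    _ = _ := by
        rw [ENNReal.ofReal_mul (p := T + T * Fintype.card ι) (by positivity),
          ENNReal.ofReal_add (by positivity) (by positivity), ENNReal.ofReal_mul (by positivity)]
        simp [add_mul]

end SelfBalancingWalk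

open SelfBalancingWalk

/-- **Online Komlós setting** (Theorem 1.1).  There is a universal constant `C > 0` such that
for all `n, T ≥ 2` and every probability distribution `p` on `ℝ^n` supported on the closed
Euclidean unit ball, there is an online signing algorithm (measurable maps
`χ t : (ℝ^n)^(t+1) × [0,1]^(t+1) → {±1}`) such that when `v₁, …, v_T` are i.i.d. from `p`
and `u₁, …, u_T` are i.i.d. uniform seeds, with probability at least `1 - C/T` the
discrepancy vectors `d_t = ∑_{s ≤ t} χ_s v_s` satisfy `‖d_t‖_∞ ≤ C (log (nT))^4` for all
`t`. -/
theorem online_komlos :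
    ∃ C : ℝ, 0 < C ∧
      ∀ (n T : ℕ), 2 ≤ n → 2 ≤ T →
      ∀ (p : Measure (Fin n → ℝ)) [IsProbabilityMeasure p],
      (∀ᵐ v ∂p, Real.sqrt (∑ i, v i ^ 2) ≤ 1) →
      ∃ χ : (t : Fin T) → (Fin (t.1 + 1) → (Fin n → ℝ)) → (Fin (t.1 + 1) → ℝ) → ℝ,
        (∀ t, Measurable fun q : (Fin (t.1 + 1) → (Fin n → ℝ)) × (Fin (t.1 + 1) → ℝ) =>
            χ t q.1 q.2) ∧
        (∀ t v u, χ t v u = 1 ∨ χ t v u = -1) ∧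
        ((Measure.pi fun _ : Fin T => p).prod
            (Measure.pi fun _ : Fin T => volume.restrict (Set.Icc (0:ℝ) 1)))
          {ω : (Fin T → (Fin n → ℝ)) × (Fin T → ℝ) |
            ∀ t : Fin T, ∀ i : Fin n,
              |(∑ s ∈ Finset.Iic t,
                  χ s (fun j => ω.1 (Fin.castLE s.isLt j)) (fun j => ω.2 (Fin.castLE s.isLt j))
                    • ω.1 s) i| ≤ C * Real.log ((n : ℝ) * T) ^ 4 } ≥
          ENNReal.ofReal (1 - C / T) := by
  refine ⟨4, by norm_num, fun n T hn hT p _ hp => ?_⟩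
  have hn' : (2 : ℝ) ≤ n := by exact_mod_cast hn
  have hT' : (2 : ℝ) ≤ T := by exact_mod_cast hT
  have hN : (4 : ℝ) ≤ n * T := by nlinarith
  have hlog : 1 ≤ log ((n : ℝ) * T) := by
    rw [le_log_iff_exp_le (by linarith)]
    linarith [exp_one_lt_three]
  set c := 4 * log ((n : ℝ) * T) with hcdef
  have hc : 1 ≤ c := by linarith
  refine ⟨fun t v u => stepSign c (walk c (extendZero v) (extendZero u) t)
    (v (Fin.last _)) (u (Fin.last _)), fun t => ?_, fun t v u => stepSign_eq_or _ _ _ _, ?_⟩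
  · refine measurable_stepSign c (measurable_walk c
      (fun k => (measurable_extendZero k).comp measurable_fst)
      (fun k => (measurable_extendZero k).comp measurable_snd) t) ?_ ?_ <;> fun_prop
  have hsum : ∀ (ω : (Fin T → (Fin n → ℝ)) × (Fin T → ℝ)) (t : Fin T),
      ∑ s ∈ Finset.Iic t, stepSign c
        (walk c (extendZero fun j : Fin (s.1 + 1) => ω.1 (Fin.castLE s.isLt j))
          (extendZero fun j : Fin (s.1 + 1) => ω.2 (Fin.castLE s.isLt j)) s)
        (ω.1 (Fin.castLE s.isLt (Fin.last _))) (ω.2 (Fin.castLE s.isLt (Fin.last _))) • ω.1 s =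
      walk c (extendZero ω.1) (extendZero ω.2) (t + 1) := by
    intro ω t
    have hrange : Finset.range (t + 1) = (Finset.Iic t).map Fin.valEmbedding := by
      rw [Fin.map_valEmbedding_Iic]; ext; simp
    rw [walk_eq_sum, hrange, Finset.sum_map]
    refine Finset.sum_congr rfl fun s _ => ?_
    have hext : ∀ {α : Type} [Zero α] (a : Fin T → α), ∀ k < s.1,
        extendZero (fun j : Fin (s.1 + 1) => a (Fin.castLE s.isLt j)) k = extendZero a k := by
      intro α _ a k hk
      simp [extendZero, hk.trans s.isLt, hk.trans (Nat.lt_succ_self _)]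
    rw [walk_congr c (hext ω.1) (hext ω.2)]
    have hlast : Fin.castLE s.isLt (Fin.last s.1) = s := rfl
    simp [extendZero, hlast]
  simp only [hsum]
  set S := {ω : (Fin T → (Fin n → ℝ)) × (Fin T → ℝ) | ∀ t : Fin T, ∀ i : Fin n,
    |walk c (extendZero ω.1) (extendZero ω.2) (t + 1) i| ≤ 4 * log ((n : ℝ) * T) ^ 4} with hS
  have hSm : MeasurableSet S := by
    simp only [hS, Set.ofPred_forall]
    refine MeasurableSet.iInter fun t => MeasurableSet.iInter fun i => ?_
    have := measurable_walk c
      (fun k => (measurable_extendZero (α := Fin n → ℝ) (m := T) k).comp measurable_fst)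
      (fun k => (measurable_extendZero (α := ℝ) (m := T) k).comp measurable_snd) (t + 1)
    exact measurableSet_le (((measurable_pi_apply i).comp this).abs) measurable_const
  have hball : ∀ᵐ v ∂(Measure.pi fun _ : Fin T => p), ∀ t, v t ⬝ᵥ v t ≤ 1 := by
    refine ae_all_iff.2 fun t => ?_
    refine (Measure.quasiMeasurePreserving_eval (fun _ : Fin T => p) t).ae
      (p := fun x => x ⬝ᵥ x ≤ 1) ?_
    filter_upwards [hp] with x hx
    simpa [dotProduct, sq] using (sqrt_le_iff.1 hx).2
  have hcompl : ((Measure.pi fun _ : Fin T => p).prod (Measure.pi fun _ : Fin T => unitUniform)) Sᶜ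
      ≤ ENNReal.ofReal (4 / T) := by
    rw [Measure.prod_apply hSm.compl]
    refine (lintegral_mono_ae (g := fun _ => ENNReal.ofReal (4 / T)) ?_).trans_eq (by simp)
    filter_upwards [hball] with v hv
    have hv' : ∀ k, extendZero v k ⬝ᵥ extendZero v k ≤ 1 := fun k => by
      unfold extendZero; split_ifs <;> simp [hv]
    refine (measure_mono ?_).trans
      ((measure_exists_walk_gt_le hc hv').trans (ENNReal.ofReal_le_ofReal ?_))
    · intro u hu
      simp only [Set.mem_preimage, Set.mem_compl_iff, hS, Set.mem_ofPred_eq, not_forall,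
        not_le] at hu
      obtain ⟨t, i, h⟩ := hu
      refine ⟨t, i, lt_of_le_of_lt ?_ h⟩
      have := le_self_pow₀ hlog (n := 4) (by norm_num)
      linarith
    · have hexp : exp (-c / 2) = ((n : ℝ) * T)⁻¹ ^ 2 := by
        rw [show -c / 2 = -log ((n : ℝ) * T) + -log ((n : ℝ) * T) by rw [hcdef]; ring, exp_add,
          exp_neg, exp_log (by linarith), sq]
      rw [hexp, Fintype.card_fin]
      have hn0 : (0 : ℝ) < n := by linarith
      have hT0 : (0 : ℝ) < T := by linarith
      field_simp
      nlinarith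
  have hone := prob_compl_eq_one_sub (μ := (Measure.pi fun _ : Fin T => p).prod
    (Measure.pi fun _ : Fin T => unitUniform)) hSm.compl
  rw [compl_compl] at hone
  rw [ge_iff_le, hone, ENNReal.ofReal_sub _ (by positivity), ENNReal.ofReal_one]
  exact tsub_le_tsub_left hcompl 1
end

section
/- For every integer d ≥ 1 there is a constant C_d > 0 (depending only on d) such that for all T ≥ 2 and every probability distribution p on [0,1]^d, there exists an online signing algorithm (a family of measurable maps χ_t : ([0,1]^d)^t × [0,1]^t → {−1,+1}) such that, when x_1,…,x_T are i.i.d. with law p and u_1,…,u_T are independent i.i.d. uniform seeds, with probability at least 1 − C_d/T the following holds: for every axis-parallel box B = I_1 × ⋯ × I_d with each I_i an interval contained in [0,1], and every t ∈ {1,…,T}, one has |Σ_{s=1}^t χ_s·1_B(x_s)| ≤ C_d·(log T)^{d+4}. -/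
open MeasureTheory Real

open scoped RealInnerProductSpace

/-- The biased random sign: `1` with probability `(1 - z / κ) / 2` under a uniform seed `y`. -/
noncomputable def biasedSign (κ z y : ℝ) : ℝ := if y ≤ (1 - z / κ) / 2 then 1 else -1

instance isProbabilityMeasure_unitInterval :
    IsProbabilityMeasure (volume.restrict (Set.Icc (0:ℝ) 1)) := ⟨by simp⟩

lemma biasedSign_eq_or (κ z y : ℝ) : biasedSign κ z y = 1 ∨ biasedSign κ z y = -1 := by
  unfold biasedSign; split_ifs <;> simp

lemma measurable_biasedSign (κ : ℝ) : Measurable fun q : ℝ × ℝ => biasedSign κ q.1 q.2 := by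
  unfold biasedSign
  refine Measurable.ite (measurableSet_le ?_ ?_) measurable_const measurable_const <;> fun_prop

lemma integral_biasedSign {κ z : ℝ} (hκ : 0 < κ) (hz : |z| ≤ κ) :
    ∫ y in Set.Icc (0:ℝ) 1, biasedSign κ z y = -(z / κ) := by
  have h1 : |z / κ| ≤ 1 := by
    rw [abs_div, abs_of_pos hκ]; exact (div_le_one hκ).2 hz
  obtain ⟨h2, h3⟩ := abs_le.1 h1
  set s := z / κ with hs
  have h4 : biasedSign κ z = fun y => (Set.Iic ((1 - s) / 2)).indicator (fun _ => (2:ℝ)) y - 1 := by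
    funext y
    simp only [biasedSign, Set.indicator, Set.mem_Iic, ← hs]
    split_ifs <;> norm_num
  have h5 : Set.Iic ((1 - s) / 2) ∩ Set.Icc 0 1 = Set.Icc 0 ((1 - s) / 2) := by
    ext y; simp only [Set.mem_inter_iff, Set.mem_Iic, Set.mem_Icc]
    constructor
    · rintro ⟨a, b, c⟩; exact ⟨b, a⟩
    · rintro ⟨a, b⟩; exact ⟨b, a, by linarith⟩
  rw [h4, integral_sub ((integrable_const _).indicator measurableSet_Iic) (integrable_const _),
    integral_indicator measurableSet_Iic, Measure.restrict_restrict measurableSet_Iic, h5]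
  simp [Measure.real]
  rw [ENNReal.toReal_ofReal (by linarith)]; ring

lemma lintegral_exp_biasedSign_le {κ z : ℝ} (hκ : 0 < κ) (hz : |z| ≤ κ) (a : ℝ) :
    ∫⁻ y in Set.Icc (0:ℝ) 1, ENNReal.ofReal (exp (a * biasedSign κ z y)) ≤
      ENNReal.ofReal (exp (a ^ 2 / 2 - a * (z / κ))) := by
  have hm : Measurable (biasedSign κ z) :=
    (measurable_biasedSign κ).comp (measurable_const.prodMk measurable_id)
  have hb : ∀ y, biasedSign κ z y ∈ Set.Icc (-1:ℝ) 1 := fun y => by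
    rcases biasedSign_eq_or κ z y with h | h <;> rw [h] <;> norm_num
  have hsub := ProbabilityTheory.hasSubgaussianMGF_of_mem_Icc
    (μ := volume.restrict (Set.Icc (0:ℝ) 1)) hm.aemeasurable (Filter.Eventually.of_forall hb)
  have hle := hsub.mgf_le a
  have hint := hsub.integrable_exp_mul a
  rw [integral_biasedSign hκ hz] at hle hint
  have hc : (((‖(1:ℝ) - (-1)‖₊ / 2) ^ 2 : NNReal) : ℝ) = 1 := by norm_num
  rw [hc] at hle
  unfold ProbabilityTheory.mgf at hle
  have e1 : ∀ y, exp (a * biasedSign κ z y) =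
      exp (-(a * (z / κ))) * exp (a * (biasedSign κ z y - -(z / κ))) := fun y => by
    rw [← exp_add]; ring_nf
  simp_rw [e1]
  rw [← ofReal_integral_eq_lintegral_ofReal (hint.const_mul _)
    (Filter.Eventually.of_forall fun y => by positivity), integral_const_mul]
  apply ENNReal.ofReal_le_ofReal
  calc _ ≤ exp (-(a * (z / κ))) * exp (1 * a ^ 2 / 2) := by gcongr
    _ = _ := by rw [← exp_add]; ring_nf

section Walk

/-- Extension of a finite sequence by zero. -/
def extendByZero {α : Type*} [Zero α] {n : ℕ} (u : Fin n → α) (j : ℕ) : α :=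
  if h : j < n then u ⟨j, h⟩ else 0

lemma extendByZero_fin {α : Type*} [Zero α] {n : ℕ} (u : Fin n → α) (j : Fin n) :
    extendByZero u j = u j := by simp [extendByZero]

lemma measurable_extendByZero {α : Type*} [Zero α] [MeasurableSpace α] (n : ℕ) :
    Measurable (extendByZero : (Fin n → α) → ℕ → α) := by
  refine measurable_pi_lambda _ fun j => ?_
  unfold extendByZero
  split_ifs
  · exact measurable_pi_apply _
  · exact measurable_const

lemma extendByZero_update_of_ne {α : Type*} [Zero α] {n : ℕ} (u : Fin n → α) (i : Fin n) (y : α)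
    {j : ℕ} (h : j ≠ i) : extendByZero (Function.update u i y) j = extendByZero u j := by
  unfold extendByZero
  split_ifs with hj
  · rw [Function.update_of_ne]
    rintro rfl
    exact h rfl
  · rfl

variable {E : Type*} [NormedAddCommGroup E] [InnerProductSpace ℝ E]

/-- The self-balancing walk: the vector `v t` is added with a random sign biased against
its inner product with the current position. -/
noncomputable def balancingWalk (κ : ℝ) (v : ℕ → E) (u : ℕ → ℝ) : ℕ → E
  | 0 => 0
  | t + 1 => balancingWalk κ v u t +
      biasedSign κ ⟪balancingWalk κ v u t, v t⟫ (u t) • v t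

/-- The sign chosen by the self-balancing walk at time `t`. -/
noncomputable def balancingSign (κ : ℝ) (v : ℕ → E) (u : ℕ → ℝ) (t : ℕ) : ℝ :=
  biasedSign κ ⟪balancingWalk κ v u t, v t⟫ (u t)

lemma balancingWalk_succ (κ : ℝ) (v : ℕ → E) (u : ℕ → ℝ) (t : ℕ) :
    balancingWalk κ v u (t + 1) = balancingWalk κ v u t + balancingSign κ v u t • v t := rfl

lemma balancingWalk_eq_sum (κ : ℝ) (v : ℕ → E) (u : ℕ → ℝ) (t : ℕ) :
    balancingWalk κ v u t = ∑ s ∈ Finset.range t, balancingSign κ v u s • v s := by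
  induction t with
  | zero => rfl
  | succ t ih => rw [balancingWalk_succ, ih, Finset.sum_range_succ]

lemma balancingWalk_congr {κ : ℝ} {v v' : ℕ → E} {u u' : ℕ → ℝ} {t : ℕ}
    (hv : ∀ s < t, v s = v' s) (hu : ∀ s < t, u s = u' s) :
    balancingWalk κ v u t = balancingWalk κ v' u' t := by
  induction t with
  | zero => rfl
  | succ t ih =>
    have := ih (fun s hs => hv s (by omega)) (fun s hs => hu s (by omega))
    simp only [balancingWalk, this, hv t (by omega), hu t (by omega)]

lemma balancingSign_congr {κ : ℝ} {v v' : ℕ → E} {u u' : ℕ → ℝ} {t : ℕ}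
    (hv : ∀ s ≤ t, v s = v' s) (hu : ∀ s ≤ t, u s = u' s) :
    balancingSign κ v u t = balancingSign κ v' u' t := by
  unfold balancingSign
  rw [balancingWalk_congr (fun s hs => hv s hs.le) (fun s hs => hu s hs.le), hv t le_rfl,
    hu t le_rfl]

/-- The inner products deciding the signs before time `t` have been at most `κ`. -/
def IsUnclamped (κ : ℝ) (v : ℕ → E) (u : ℕ → ℝ) (t : ℕ) : Prop :=
  ∀ s < t, |⟪balancingWalk κ v u s, v s⟫| ≤ κ

lemma isUnclamped_congr {κ : ℝ} {v : ℕ → E} {u u' : ℕ → ℝ} {t : ℕ}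
    (hu : ∀ s < t, u s = u' s) : IsUnclamped κ v u t ↔ IsUnclamped κ v u' t := by
  unfold IsUnclamped
  refine forall₂_congr fun s hs => ?_
  rw [balancingWalk_congr (fun _ _ => rfl) fun r hr => hu r (hr.trans hs)]

open Classical in
/-- The exponential of the inner product of the walk with `θ`, killed once the walk has been
clamped. -/
noncomputable def killedExp (κ : ℝ) (v : ℕ → E) (θ : E) (t : ℕ) (u : ℕ → ℝ) : ENNReal :=
  if IsUnclamped κ v u t then ENNReal.ofReal (exp ⟪θ, balancingWalk κ v u t⟫) else 0

lemma killedExp_congr {κ : ℝ} {v : ℕ → E} {θ : E} {t : ℕ} {u u' : ℕ → ℝ}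
    (hu : ∀ s < t, u s = u' s) : killedExp κ v θ t u = killedExp κ v θ t u' := by
  unfold killedExp
  have h := isUnclamped_congr (κ := κ) (v := v) hu
  rw [balancingWalk_congr (fun _ _ => rfl) hu]
  split_ifs <;> first | rfl | tauto

variable [MeasurableSpace E] [BorelSpace E] [SecondCountableTopology E]

lemma measurable_balancingWalk (κ : ℝ) (t : ℕ) :
    Measurable fun q : (ℕ → E) × (ℕ → ℝ) => balancingWalk κ q.1 q.2 t := by
  induction t with
  | zero => exact measurable_const
  | succ t ih =>
    have hv : Measurable fun q : (ℕ → E) × (ℕ → ℝ) => q.1 t :=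
      (measurable_pi_apply t).comp measurable_fst
    have hu : Measurable fun q : (ℕ → E) × (ℕ → ℝ) => q.2 t :=
      (measurable_pi_apply t).comp measurable_snd
    exact ih.add (((measurable_biasedSign κ).comp ((ih.inner hv).prodMk hu)).smul hv)

lemma measurable_inner_balancingWalk (κ : ℝ) (t : ℕ) :
    Measurable fun q : (ℕ → E) × (ℕ → ℝ) => ⟪balancingWalk κ q.1 q.2 t, q.1 t⟫ :=
  (measurable_balancingWalk κ t).inner ((measurable_pi_apply t).comp measurable_fst)

lemma measurable_balancingSign (κ : ℝ) (t : ℕ) :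
    Measurable fun q : (ℕ → E) × (ℕ → ℝ) => balancingSign κ q.1 q.2 t :=
  (measurable_biasedSign κ).comp
    ((measurable_inner_balancingWalk κ t).prodMk ((measurable_pi_apply t).comp measurable_snd))

lemma measurableSet_isUnclamped (κ : ℝ) (t : ℕ) :
    MeasurableSet {q : (ℕ → E) × (ℕ → ℝ) | IsUnclamped κ q.1 q.2 t} := by
  simp only [IsUnclamped, Set.ofPred_forall]
  refine MeasurableSet.iInter fun s => MeasurableSet.iInter fun _ => measurableSet_le ?_
    measurable_const
  simpa only [Real.norm_eq_abs] using (measurable_inner_balancingWalk κ s).norm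

/-- The law of `T` independent uniform seeds. -/
noncomputable abbrev seedMeasure (T : ℕ) : Measure (Fin T → ℝ) :=
  Measure.pi fun _ : Fin T => volume.restrict (Set.Icc (0:ℝ) 1)

lemma measurable_killedExp (κ : ℝ) (v : ℕ → E) (θ : E) (t : ℕ) :
    Measurable (killedExp κ v θ t) := by
  classical
  have hp : Measurable fun u : ℕ → ℝ => (v, u) := measurable_const.prodMk measurable_id
  refine Measurable.ite (hp (measurableSet_isUnclamped κ t)) ?_ measurable_const
  exact (measurable_exp.comp
    (measurable_const.inner ((measurable_balancingWalk κ t).comp hp))).ennreal_ofReal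

lemma lintegral_killedExp_succ_le {κ : ℝ} (hκ : 0 < κ) (v : ℕ → E) (θ : E) {T t : ℕ}
    (ht : t < T) :
    ∫⁻ u, killedExp κ v θ (t + 1) (extendByZero u) ∂seedMeasure T ≤
      ∫⁻ u, ENNReal.ofReal (exp (⟪θ, v t⟫ ^ 2 / 2)) *
        killedExp κ v (θ - (⟪θ, v t⟫ / κ) • v t) t (extendByZero u) ∂seedMeasure T := by
  have hme := measurable_extendByZero (α := ℝ) T
  refine lintegral_le_of_lmarginal_le {⟨t, ht⟩} ((measurable_killedExp _ _ _ _).comp hme)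
    (((measurable_killedExp _ _ _ _).comp hme).const_mul _) ?_
  rw [lmarginal_singleton, lmarginal_singleton]
  intro u
  have hu : ∀ y, ∀ s < t, extendByZero (Function.update u ⟨t, ht⟩ y) s = extendByZero u s :=
    fun y s hs => extendByZero_update_of_ne _ _ _ (by simpa using hs.ne)
  have hut : ∀ y, extendByZero (Function.update u ⟨t, ht⟩ y) t = y := fun y => by
    simp [extendByZero, ht]
  simp_rw [killedExp_congr (hu _)]
  rw [lintegral_const, measure_univ, mul_one]
  by_cases hG : IsUnclamped κ v (extendByZero u) t ∧
      |⟪balancingWalk κ v (extendByZero u) t, v t⟫| ≤ κ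
  · obtain ⟨hG, hz⟩ := hG
    set w := balancingWalk κ v (extendByZero u) t with hw
    set a := ⟪θ, v t⟫ with ha
    have key : ∀ y, killedExp κ v θ (t + 1) (extendByZero (Function.update u ⟨t, ht⟩ y)) ≤
        ENNReal.ofReal (exp ⟪θ, w⟫) * ENNReal.ofReal (exp (a * biasedSign κ ⟪w, v t⟫ y)) := by
      intro y
      unfold killedExp
      split_ifs
      · rw [← ENNReal.ofReal_mul (exp_pos _).le, ← exp_add, balancingWalk_succ, balancingSign,
          balancingWalk_congr (fun _ _ => rfl) (hu y), hut, ← hw, inner_add_right,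
          real_inner_smul_right, mul_comm _ ⟪θ, v t⟫]
      · exact zero_le
    refine (lintegral_mono key).trans ?_
    rw [lintegral_const_mul' _ _ ENNReal.ofReal_ne_top]
    refine (mul_le_mul_right (lintegral_exp_biasedSign_le hκ hz a) _).trans ?_
    rw [killedExp, if_pos hG, ← hw, ← ENNReal.ofReal_mul (exp_pos _).le,
      ← ENNReal.ofReal_mul (exp_pos _).le, ← exp_add, ← exp_add, inner_sub_left,
      real_inner_smul_left, real_inner_comm (v t) w]
    apply le_of_eq
    ring_nf
  · have key : ∀ y, killedExp κ v θ (t + 1) (extendByZero (Function.update u ⟨t, ht⟩ y)) = 0 := by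
      intro y
      unfold killedExp
      rw [if_neg]
      intro h
      refine hG ⟨fun s hs => ?_, ?_⟩
      · rw [← balancingWalk_congr (fun _ _ => rfl) (fun r hr => hu y r (hr.trans hs))]
        exact h s (by omega)
      · rw [← balancingWalk_congr (fun _ _ => rfl) (hu y)]
        exact h t (by omega)
    simp [key]

theorem lintegral_killedExp_le {κ : ℝ} (hκ : 0 < κ) {v : ℕ → E} (hv : ∀ s, ‖v s‖ ^ 2 ≤ κ)
    {T t : ℕ} (ht : t ≤ T) (θ : E) :
    ∫⁻ u, killedExp κ v θ t (extendByZero u) ∂seedMeasure T ≤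
      ENNReal.ofReal (exp (κ * ‖θ‖ ^ 2 / 2)) := by
  induction t generalizing θ with
  | zero =>
    have : ∀ u, killedExp κ v θ 0 u ≤ 1 := fun u => by
      unfold killedExp; split_ifs <;> simp [balancingWalk]
    refine (lintegral_mono fun u => this _).trans ?_
    simp only [lintegral_const, measure_univ, mul_one]
    rw [← ENNReal.ofReal_one]
    exact ENNReal.ofReal_le_ofReal (one_le_exp (by positivity))
  | succ t ih =>
    refine (lintegral_killedExp_succ_le hκ v θ (by omega)).trans ?_
    rw [lintegral_const_mul' _ _ ENNReal.ofReal_ne_top]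
    refine (mul_le_mul_right (ih (by omega) _) _).trans ?_
    rw [← ENNReal.ofReal_mul (exp_pos _).le, ← exp_add]
    apply ENNReal.ofReal_le_ofReal
    apply exp_le_exp.2
    rw [norm_sub_sq_real, real_inner_smul_right, norm_smul, mul_pow, Real.norm_eq_abs, sq_abs]
    set a := ⟪θ, v t⟫
    have h1 : (a / κ) ^ 2 * ‖v t‖ ^ 2 ≤ (a / κ) ^ 2 * κ := by gcongr; exact hv t
    have h2 : κ * ((a / κ) ^ 2 * κ) = a ^ 2 := by field_simp
    have h3 : κ * (a / κ * a) = a ^ 2 := by field_simp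
    nlinarith [mul_le_mul_of_nonneg_left h1 hκ.le]

lemma seedMeasure_lt_inner_le {M c ρ : ℝ} (hM : 0 < M) (hc : 1 ≤ c) (hρ : 0 < ρ) {v : ℕ → E}
    (hv : ∀ s, ‖v s‖ ^ 2 ≤ M) {T t : ℕ} (ht : t ≤ T) {θ : E} (hθ : ‖θ‖ ^ 2 ≤ ρ ^ 2 * M) :
    seedMeasure T {u | IsUnclamped (c * M) v (extendByZero u) t ∧
      c * ρ * M < ⟪θ, balancingWalk (c * M) v (extendByZero u) t⟫} ≤
      ENNReal.ofReal (exp (-(c / 2))) := by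
  have hκ : 0 < c * M := by positivity
  set r := 1 / (ρ * M) with hr
  have hr0 : 0 < r := by positivity
  have hmgf := lintegral_killedExp_le hκ (v := v) (fun s => (hv s).trans (by nlinarith)) ht (r • θ)
  have hmeas : Measurable fun u : Fin T → ℝ => killedExp (c * M) v (r • θ) t (extendByZero u) :=
    (measurable_killedExp _ _ _ _).comp (measurable_extendByZero T)
  have hmarkov := mul_meas_ge_le_lintegral (μ := seedMeasure T) hmeas (ENNReal.ofReal (exp c))
  have hsub : {u : Fin T → ℝ | IsUnclamped (c * M) v (extendByZero u) t ∧
      c * ρ * M < ⟪θ, balancingWalk (c * M) v (extendByZero u) t⟫} ⊆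
      {u | ENNReal.ofReal (exp c) ≤ killedExp (c * M) v (r • θ) t (extendByZero u)} := by
    rintro u ⟨h1, h2⟩
    simp only [Set.mem_ofPred_eq, killedExp, if_pos h1, real_inner_smul_left]
    apply ENNReal.ofReal_le_ofReal
    apply exp_le_exp.2
    calc c = r * (c * ρ * M) := by rw [hr]; field_simp
      _ ≤ _ := by gcongr
  have hexp : c * M * ‖r • θ‖ ^ 2 / 2 ≤ c / 2 := by
    rw [norm_smul, mul_pow, Real.norm_eq_abs, sq_abs]
    calc c * M * (r ^ 2 * ‖θ‖ ^ 2) / 2 ≤ c * M * (r ^ 2 * (ρ ^ 2 * M)) / 2 := by gcongr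
      _ = c / 2 := by rw [hr]; field_simp
  have hfin := (mul_le_mul_right (measure_mono (μ := seedMeasure T) hsub)
    (ENNReal.ofReal (exp c))).trans (hmarkov.trans hmgf)
  have hne : ENNReal.ofReal (exp c) ≠ 0 := by simp [exp_pos]
  rw [← ENNReal.mul_le_mul_iff_right hne ENNReal.ofReal_ne_top]
  refine hfin.trans ?_
  rw [← ENNReal.ofReal_mul (exp_pos _).le, ← exp_add]
  apply ENNReal.ofReal_le_ofReal
  apply exp_le_exp.2
  linarith

lemma seedMeasure_lt_abs_inner_le {M c ρ : ℝ} (hM : 0 < M) (hc : 1 ≤ c) (hρ : 0 < ρ) {v : ℕ → E}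
    (hv : ∀ s, ‖v s‖ ^ 2 ≤ M) {T t : ℕ} (ht : t ≤ T) {θ : E} (hθ : ‖θ‖ ^ 2 ≤ ρ ^ 2 * M) :
    seedMeasure T {u | IsUnclamped (c * M) v (extendByZero u) t ∧
      c * ρ * M < |⟪θ, balancingWalk (c * M) v (extendByZero u) t⟫|} ≤
      ENNReal.ofReal (2 * exp (-(c / 2))) := by
  have h1 := seedMeasure_lt_inner_le hM hc hρ hv ht hθ
  have h2 := seedMeasure_lt_inner_le hM hc hρ hv ht (θ := -θ) (by rwa [norm_neg])
  rw [two_mul, ENNReal.ofReal_add (exp_pos _).le (exp_pos _).le]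
  refine le_trans (measure_mono ?_) ((measure_union_le _ _).trans (add_le_add h1 h2))
  rintro u ⟨hG, hu⟩
  rcases lt_abs.1 hu with h | h
  · exact Or.inl ⟨hG, h⟩
  · exact Or.inr ⟨hG, by rwa [inner_neg_left]⟩

end Walk

section Dyadic

lemma sum_dyadic_ite (L x a : ℕ) (hx : x < 2 ^ L) (ha : a < 2 ^ L) :
    ∑ l ∈ Finset.range L, (if a / 2 ^ l = x / 2 ^ l + 1 ∧ a / 2 ^ l % 2 = 1 then (1:ℝ) else 0) =
      if x < a then 1 else 0 := by
  induction L generalizing x a with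
  | zero => simp at hx ha; simp [hx, ha]
  | succ L ih =>
    rw [Finset.sum_range_succ']
    have h2 : ∀ y l : ℕ, y / 2 ^ (l + 1) = y / 2 / 2 ^ l := fun y l => by
      rw [pow_succ', Nat.div_div_eq_div_mul]
    simp_rw [h2]
    rw [ih (x / 2) (a / 2) (by omega) (by omega)]
    simp only [pow_zero, Nat.div_one]
    split_ifs <;> first | omega | norm_num

/-- The indicator, over dyadic intervals of length `2 ^ l` and index `j`, of containing `x`. -/
noncomputable def dyadicPoint (L x : ℕ) (m : Fin L × Fin (2 ^ L)) : ℝ :=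
  if x / 2 ^ m.1.1 = m.2.1 then 1 else 0

/-- The dyadic intervals whose disjoint union is `{0, …, a - 1}`. -/
noncomputable def dyadicPrefix (L a : ℕ) (m : Fin L × Fin (2 ^ L)) : ℝ :=
  if a / 2 ^ m.1.1 = m.2.1 + 1 ∧ a / 2 ^ m.1.1 % 2 = 1 then 1 else 0

/-- The signed combination of dyadic intervals representing `{lo, …, hi - 1}`. -/
noncomputable def dyadicInterval (L lo hi : ℕ) (m : Fin L × Fin (2 ^ L)) : ℝ :=
  dyadicPrefix L hi m - dyadicPrefix L lo m

lemma sum_dyadicPrefix_mul_dyadicPoint {L x a : ℕ} (hx : x < 2 ^ L) (ha : a < 2 ^ L) :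
    ∑ m, dyadicPrefix L a m * dyadicPoint L x m = if x < a then 1 else 0 := by
  rw [← sum_dyadic_ite L x a hx ha, Fintype.sum_prod_type, Finset.sum_range]
  refine Finset.sum_congr rfl fun l _ => ?_
  have hlt : x / 2 ^ l.1 < 2 ^ L := (Nat.div_le_self _ _).trans_lt hx
  rw [Finset.sum_eq_single ⟨x / 2 ^ l.1, hlt⟩]
  · simp [dyadicPrefix, dyadicPoint]
  · intro j _ hj
    have : x / 2 ^ l.1 ≠ j.1 := fun h => hj (Fin.ext h.symm)
    simp [dyadicPoint, this]
  · simp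

lemma sum_dyadicPoint_sq {L x : ℕ} (hx : x < 2 ^ L) :
    ∑ m, dyadicPoint L x m * dyadicPoint L x m = L := by
  rw [Fintype.sum_prod_type]
  have : ∀ l : Fin L, ∑ j, dyadicPoint L x (l, j) * dyadicPoint L x (l, j) = 1 := by
    intro l
    have hlt : x / 2 ^ l.1 < 2 ^ L := (Nat.div_le_self _ _).trans_lt hx
    rw [Finset.sum_eq_single ⟨x / 2 ^ l.1, hlt⟩]
    · simp [dyadicPoint]
    · intro j _ hj
      have : x / 2 ^ l.1 ≠ j.1 := fun h => hj (Fin.ext h.symm)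
      simp [dyadicPoint, this]
    · simp
  simp [this]

lemma sum_dyadicPrefix_sq_le (L a : ℕ) :
    ∑ m, dyadicPrefix L a m * dyadicPrefix L a m ≤ L := by
  rw [Fintype.sum_prod_type]
  have : ∀ l : Fin L, ∑ j, dyadicPrefix L a (l, j) * dyadicPrefix L a (l, j) ≤ 1 := by
    intro l
    calc _ ≤ ∑ j : Fin (2 ^ L), if a / 2 ^ l.1 = j.1 + 1 then (1:ℝ) else 0 := by
          refine Finset.sum_le_sum fun j _ => ?_
          unfold dyadicPrefix
          split_ifs <;> simp_all
      _ ≤ 1 := by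
          rw [Finset.sum_boole]
          norm_cast
          rw [Finset.card_le_one]
          intro i hi j hj
          simp only [Finset.mem_filter, Finset.mem_univ, true_and] at hi hj
          exact Fin.ext (by omega)
  calc _ ≤ ∑ _l : Fin L, (1:ℝ) := Finset.sum_le_sum fun l _ => this l
    _ = L := by simp

lemma sum_dyadicInterval_sq_le (L lo hi : ℕ) :
    ∑ m, dyadicInterval L lo hi m * dyadicInterval L lo hi m ≤ 4 * L := by
  calc _ ≤ ∑ m, (2 * (dyadicPrefix L hi m * dyadicPrefix L hi m) +
          2 * (dyadicPrefix L lo m * dyadicPrefix L lo m)) := by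
        refine Finset.sum_le_sum fun m _ => ?_
        unfold dyadicInterval
        nlinarith [sq_nonneg (dyadicPrefix L hi m + dyadicPrefix L lo m)]
    _ ≤ _ := by
        rw [Finset.sum_add_distrib, ← Finset.mul_sum, ← Finset.mul_sum]
        linarith [sum_dyadicPrefix_sq_le L hi, sum_dyadicPrefix_sq_le L lo]

lemma sum_dyadicInterval_mul_dyadicPoint {L x lo hi : ℕ} (hx : x < 2 ^ L) (hlo : lo < 2 ^ L)
    (hhi : hi < 2 ^ L) (h : lo ≤ hi) :
    ∑ m, dyadicInterval L lo hi m * dyadicPoint L x m = if lo ≤ x ∧ x < hi then 1 else 0 := by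
  simp only [dyadicInterval, sub_mul, Finset.sum_sub_distrib,
    sum_dyadicPrefix_mul_dyadicPoint hx hlo, sum_dyadicPrefix_mul_dyadicPoint hx hhi]
  split_ifs <;> first | omega | norm_num

/-- The tensor product of a finite family of real vectors. -/
noncomputable def tensorVec {d : ℕ} {ι : Type*} (f : Fin d → ι → ℝ) :
    EuclideanSpace ℝ (Fin d → ι) :=
  WithLp.toLp 2 fun m => ∏ i, f i (m i)

lemma inner_tensorVec {d : ℕ} {ι : Type*} [Fintype ι] (f g : Fin d → ι → ℝ) :
    ⟪tensorVec f, tensorVec g⟫ = ∏ i, ∑ j, f i j * g i j := by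
  classical
  rw [Finset.prod_univ_sum, Fintype.piFinset_univ]
  simp only [tensorVec, PiLp.inner_apply, RCLike.inner_apply, conj_trivial, Finset.prod_mul_distrib]
  exact Finset.sum_congr rfl fun _ _ => mul_comm _ _

lemma norm_tensorVec_sq {d : ℕ} {ι : Type*} [Fintype ι] (f : Fin d → ι → ℝ) :
    ‖tensorVec f‖ ^ 2 = ∏ i, ∑ j, f i j * f i j := by
  rw [← inner_tensorVec, real_inner_self_eq_norm_sq]

end Dyadic

section Collision

/-- The quantile index of a real number in a partition into about `N` cells. -/
noncomputable def quantileIndex (ν : Measure ℝ) (N : ℕ) (x : ℝ) : ℕ :=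
  ⌊(N : ℝ) * ProbabilityTheory.cdf ν x⌋₊

lemma monotone_quantileIndex (ν : Measure ℝ) (N : ℕ) : Monotone (quantileIndex ν N) :=
  fun _ _ h => Nat.floor_le_floor
    (mul_le_mul_of_nonneg_left (ProbabilityTheory.monotone_cdf ν h) (Nat.cast_nonneg _))

lemma quantileIndex_le (ν : Measure ℝ) (N : ℕ) (x : ℝ) : quantileIndex ν N x ≤ N := by
  apply Nat.floor_le_of_le
  exact mul_le_of_le_one_right (Nat.cast_nonneg _) (ProbabilityTheory.cdf_le_one ν x)

lemma measurable_quantileIndex (ν : Measure ℝ) (N : ℕ) : Measurable (quantileIndex ν N) :=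
  (monotone_quantileIndex ν N).measurable

lemma measure_quantileIndex_eq_le (ν : Measure ℝ) [IsProbabilityMeasure ν] {N : ℕ} (hN : 0 < N)
    (x : ℝ) :
    ν {y | quantileIndex ν N x = quantileIndex ν N y ∧ x < y} ≤ ENNReal.ofReal (1 / N) := by
  have hmeas : MeasurableSet {y | quantileIndex ν N x = quantileIndex ν N y ∧ x < y} :=
    (measurableSet_eq_fun measurable_const (measurable_quantileIndex ν N)).inter
      (measurableSet_lt measurable_const measurable_id)
  by_contra! hlt
  obtain ⟨K, hKS, hK, hlt⟩ := hmeas.exists_lt_isCompact hlt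
  have hne : K.Nonempty := by
    rw [Set.nonempty_iff_ne_empty]
    rintro rfl
    simp at hlt
  obtain ⟨m, hmK, hm⟩ := hK.exists_isGreatest hne
  obtain ⟨hq, hxm⟩ := hKS hmK
  have hsub : K ⊆ Set.Ioc x m := fun y hy => ⟨(hKS hy).2, hm hy⟩
  have hIoc : ν (Set.Ioc x m) =
      ENNReal.ofReal (ProbabilityTheory.cdf ν m - ProbabilityTheory.cdf ν x) := by
    rw [← StieltjesFunction.measure_Ioc, ProbabilityTheory.measure_cdf]
  refine absurd (hlt.trans_le ((measure_mono hsub).trans hIoc.le)) (not_lt.2 ?_)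
  apply ENNReal.ofReal_le_ofReal
  have hN' : (0:ℝ) < N := by exact_mod_cast hN
  rw [le_div_iff₀ hN']
  unfold quantileIndex at hq
  have h1 := Nat.floor_le (mul_nonneg hN'.le (ProbabilityTheory.cdf_nonneg ν x))
  have h2 := Nat.lt_floor_add_one ((N:ℝ) * ProbabilityTheory.cdf ν m)
  rw [← hq] at h2
  linarith

lemma exists_index_interval {T : ℕ} (k : ℝ → ℕ) (hk : Monotone k) {N : ℕ} (hN : ∀ x, k x ≤ N)
    (x : Fin T → ℝ) (hx : ∀ s s', k (x s) = k (x s') → x s = x s') {I : Set ℝ}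
    (hI : I.OrdConnected) :
    ∃ lo hi : ℕ, lo ≤ hi ∧ hi < N + 2 ∧ ∀ s, x s ∈ I ↔ lo ≤ k (x s) ∧ k (x s) < hi := by
  classical
  by_cases hA : ∃ s, x s ∈ I
  · have hne : (Finset.univ.filter fun s => x s ∈ I).Nonempty := by
      obtain ⟨s, hs⟩ := hA
      exact ⟨s, by simpa using hs⟩
    obtain ⟨s1, h1, h1'⟩ := Finset.exists_min_image _ (fun s => k (x s)) hne
    obtain ⟨s2, h2, h2'⟩ := Finset.exists_max_image _ (fun s => k (x s)) hne
    simp only [Finset.mem_filter, Finset.mem_univ, true_and] at h1 h1' h2 h2'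
    refine ⟨k (x s1), k (x s2) + 1, ?_, ?_, fun s => ⟨fun hs => ⟨h1' s hs, ?_⟩, ?_⟩⟩
    · have := h2' s1 h1; omega
    · have := hN (x s2); omega
    · have := h2' s hs; omega
    · rintro ⟨ha, hb⟩
      have hle : ∀ s s', k (x s) ≤ k (x s') → x s ≤ x s' := fun s s' h => by
        rcases h.eq_or_lt with h | h
        · exact (hx _ _ h).le
        · by_contra! h'
          exact absurd (hk h'.le) (not_le.2 h)
      exact hI.out h1 h2 ⟨hle _ _ ha, hle _ _ (by omega)⟩
  · push Not at hA
    exact ⟨0, 0, le_rfl, by omega, fun s => ⟨fun h => absurd h (hA s), fun h => by omega⟩⟩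

/-- A measurable set in a product of probability spaces is small if all its fibres along one
coordinate are. -/
lemma measure_pi_le_of_update {ι α : Type*} [Fintype ι] [DecidableEq ι] [MeasurableSpace α]
    (μ : Measure α) [IsProbabilityMeasure μ] {S : Set (ι → α)} (hS : MeasurableSet S) (i : ι)
    {ε : ENNReal} (h : ∀ x, μ {y | Function.update x i y ∈ S} ≤ ε) :
    Measure.pi (fun _ : ι => μ) S ≤ ε := by
  have key := lintegral_le_of_lmarginal_le (μ := fun _ : ι => μ) {i}
    (f := S.indicator fun _ => 1) (g := fun _ => ε) (measurable_const.indicator hS)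
    measurable_const ?_
  · rw [lintegral_indicator hS] at key
    simpa using key
  · rw [lmarginal_singleton, lmarginal_singleton]
    intro x
    have : ∀ y, S.indicator (fun _ => (1:ENNReal)) (Function.update x i y) =
        {y | Function.update x i y ∈ S}.indicator (fun _ => 1) y := fun y => rfl
    simp only [this]
    have hS' : MeasurableSet {y | Function.update x i y ∈ S} := measurable_update x hS
    rw [lintegral_indicator hS']
    simpa using h x

/-- A measurable subset of a product space is small if all its sections are. -/
lemma measure_prod_le_of_section {α β : Type*} [MeasurableSpace α] [MeasurableSpace β]
    (μ : Measure α) (ν : Measure β) [IsProbabilityMeasure μ] [SFinite ν] {S : Set (α × β)}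
    (hS : MeasurableSet S) {ε : ENNReal} (h : ∀ x, ν {y | (x, y) ∈ S} ≤ ε) :
    μ.prod ν S ≤ ε := by
  rw [Measure.prod_apply hS]
  exact (lintegral_mono h).trans (by simp)

lemma measure_collision_le {T d : ℕ} (p : Measure (Fin d → ℝ)) [IsProbabilityMeasure p] {N : ℕ}
    (hN : 0 < N) (i : Fin d) (s s' : Fin T) :
    Measure.pi (fun _ : Fin T => p) {x | quantileIndex (p.map fun y => y i) N (x s i) =
      quantileIndex (p.map fun y => y i) N (x s' i) ∧ x s i < x s' i} ≤
      ENNReal.ofReal (1 / N) := by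
  have hi : Measurable fun y : Fin d → ℝ => y i := measurable_pi_apply i
  have : IsProbabilityMeasure (p.map fun y : Fin d → ℝ => y i) :=
    Measure.isProbabilityMeasure_map hi.aemeasurable
  rcases eq_or_ne s s' with rfl | hs
  · simp
  set ν := p.map fun y : Fin d → ℝ => y i with hν
  have hc : ∀ r : Fin T, Measurable fun x : Fin T → Fin d → ℝ => x r i :=
    fun r => hi.comp (measurable_pi_apply r)
  have hq := measurable_quantileIndex ν N
  refine measure_pi_le_of_update p ((measurableSet_eq_fun (hq.comp (hc s)) (hq.comp (hc s'))).inter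
    (measurableSet_lt (hc s) (hc s'))) s' fun x => ?_
  refine le_trans (le_of_eq ?_) (measure_quantileIndex_eq_le ν hN (x s i))
  rw [hν, Measure.map_apply hi, ← hν]
  · congr 1
    ext y
    simp [Function.update_of_ne hs]
  · exact (measurableSet_eq_fun measurable_const hq).inter
      (measurableSet_lt measurable_const measurable_id)

end Collision

section Main

variable {d : ℕ}

/-- The tensor feature vector of a point, built from the dyadic cells of its quantile indices. -/
noncomputable def featureVec (p : Measure (Fin d → ℝ)) (N L : ℕ) (y : Fin d → ℝ) :
    EuclideanSpace ℝ (Fin d → Fin L × Fin (2 ^ L)) :=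
  tensorVec fun i => dyadicPoint L (quantileIndex (p.map fun y => y i) N (y i))

/-- The test vector of a box of quantile indices. -/
noncomputable def boxVec (L : ℕ) {n : ℕ} (b : Fin d → Fin n × Fin n) :
    EuclideanSpace ℝ (Fin d → Fin L × Fin (2 ^ L)) :=
  tensorVec fun i => dyadicInterval L (b i).1 (b i).2

lemma measurable_featureVec (p : Measure (Fin d → ℝ)) (N L : ℕ) :
    Measurable (featureVec p N L) := by
  have h : Measurable fun y : Fin d → ℝ => fun i => quantileIndex (p.map fun y => y i) N (y i) :=
    measurable_pi_lambda _ fun i => (measurable_quantileIndex _ N).comp (measurable_pi_apply i)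
  exact (Measurable.of_discrete (f := fun k : Fin d → ℕ =>
    (tensorVec fun i => dyadicPoint L (k i)))).comp h

lemma norm_featureVec_sq (p : Measure (Fin d → ℝ)) {N L : ℕ} (hL : N < 2 ^ L) (y : Fin d → ℝ) :
    ‖featureVec p N L y‖ ^ 2 = (L : ℝ) ^ d := by
  rw [featureVec, norm_tensorVec_sq]
  simp [sum_dyadicPoint_sq ((quantileIndex_le _ N _).trans_lt hL)]

lemma norm_boxVec_sq_le (L : ℕ) {n : ℕ} (b : Fin d → Fin n × Fin n) :
    ‖boxVec L b‖ ^ 2 ≤ ((2:ℝ) ^ d) ^ 2 * (L : ℝ) ^ d := by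
  rw [boxVec, norm_tensorVec_sq]
  calc _ ≤ ∏ _i : Fin d, (4 * (L:ℝ)) := Finset.prod_le_prod
        (fun i _ => Finset.sum_nonneg fun j _ => mul_self_nonneg _)
        fun i _ => sum_dyadicInterval_sq_le L _ _
    _ = _ := by
        rw [Finset.prod_const, Finset.card_univ, Fintype.card_fin, mul_pow, ← pow_mul,
          mul_comm d 2, pow_mul]
        norm_num

lemma inner_boxVec_featureVec (p : Measure (Fin d → ℝ)) {N L : ℕ} (hL : N + 2 ≤ 2 ^ L)
    (b : Fin d → Fin (N + 2) × Fin (N + 2)) (hb : ∀ i, (b i).1 ≤ (b i).2) (y : Fin d → ℝ)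
    {I : Fin d → Set ℝ} (hI : ∀ i, y i ∈ I i ↔
      (b i).1 ≤ quantileIndex (p.map fun y => y i) N (y i) ∧
        quantileIndex (p.map fun y => y i) N (y i) < (b i).2) :
    ⟪boxVec L b, featureVec p N L y⟫ =
      Set.indicator {x : Fin d → ℝ | ∀ i, x i ∈ I i} (fun _ => (1:ℝ)) y := by
  classical
  rw [boxVec, featureVec, inner_tensorVec]
  have h : ∀ i, ∑ j, dyadicInterval L (b i).1 (b i).2 j *
      dyadicPoint L (quantileIndex (p.map fun y => y i) N (y i)) j =
        if y i ∈ I i then 1 else 0 := fun i => by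
    have := quantileIndex_le (p.map fun y => y i) N (y i)
    rw [sum_dyadicInterval_mul_dyadicPoint (by omega) (by omega) (by omega) (hb i)]
    simp only [hI i]
  simp_rw [h, Set.indicator_apply, Set.mem_ofPred_eq]
  rw [Fintype.prod_boole]
  split_ifs <;> rfl

/-- If the walk stays unclamped, all test vectors have small inner product with it and distinct
coordinates have distinct quantile indices, then every box has small discrepancy. -/
lemma abs_sum_le_of_tests (p : Measure (Fin d → ℝ)) {N L T : ℕ} (hL : N + 2 ≤ 2 ^ L)
    {κ R : ℝ} (x : Fin T → Fin d → ℝ) (u : Fin T → ℝ)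
    (hx : ∀ i s s', quantileIndex (p.map fun y => y i) N (x s i) =
      quantileIndex (p.map fun y => y i) N (x s' i) → x s i = x s' i)
    (t : Fin T)
    (htest : ∀ b : Fin d → Fin (N + 2) × Fin (N + 2), |⟪boxVec L b,
      balancingWalk κ (fun j => featureVec p N L (extendByZero x j)) (extendByZero u) (t + 1)⟫| ≤ R)
    (I : Fin d → Set ℝ) (hI : ∀ i, (I i).OrdConnected) :
    |∑ s ∈ Finset.Iic t,
      balancingSign κ (fun j => featureVec p N L (extendByZero x j)) (extendByZero u) s *
        Set.indicator {x : Fin d → ℝ | ∀ i, x i ∈ I i} (fun _ => (1:ℝ)) (x s)| ≤ R := by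
  have hex : ∀ i, ∃ lo hi : ℕ, lo ≤ hi ∧ hi < N + 2 ∧ ∀ s, x s i ∈ I i ↔
      lo ≤ quantileIndex (p.map fun y => y i) N (x s i) ∧
        quantileIndex (p.map fun y => y i) N (x s i) < hi := by
    intro i
    have hi := hx i
    generalize p.map (fun y => y i) = ν at hi ⊢
    exact exists_index_interval (quantileIndex ν N) (monotone_quantileIndex ν N)
      (quantileIndex_le ν N) (fun s => x s i) hi (hI i)
  choose lo hi hle hlt hiff using hex
  let b : Fin d → Fin (N + 2) × Fin (N + 2) :=
    fun i => (⟨lo i, (hle i).trans_lt (hlt i)⟩, ⟨hi i, hlt i⟩)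
  refine le_trans (le_of_eq ?_) (htest b)
  rw [balancingWalk_eq_sum, inner_sum]
  congr 1
  refine Finset.sum_bij (fun s _ => s.1) ?_ ?_ ?_ ?_
  · intro s hs
    rw [Finset.mem_Iic, Fin.le_def] at hs
    rw [Finset.mem_range]
    omega
  · intro s _ s' _ h
    exact Fin.ext h
  · intro j hj
    rw [Finset.mem_range] at hj
    exact ⟨⟨j, by omega⟩, by rw [Finset.mem_Iic, Fin.le_def]; simp; omega, rfl⟩
  · intro s _
    rw [real_inner_smul_right, extendByZero_fin]
    rw [inner_boxVec_featureVec p hL b (fun i => hle i) (x s) fun i => hiff i s]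

/-- While the walk is unclamped, its inner product with a point-dependent test vector is small. -/
lemma measure_lt_abs_inner_le {E : Type*} [NormedAddCommGroup E] [InnerProductSpace ℝ E]
    [MeasurableSpace E] [BorelSpace E] [SecondCountableTopology E]
    (p : Measure (Fin d → ℝ)) [IsProbabilityMeasure p] {V : (Fin d → ℝ) → E} (hV : Measurable V)
    {M c ρ : ℝ} (hM : 0 < M) (hc : 1 ≤ c) (hρ : 0 < ρ) (hVM : ∀ y, ‖V y‖ ^ 2 ≤ M)
    {T t : ℕ} (ht : t ≤ T) {θ : (Fin T → Fin d → ℝ) → E} (hθm : Measurable θ)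
    (hθ : ∀ x, ‖θ x‖ ^ 2 ≤ ρ ^ 2 * M) :
    ((Measure.pi fun _ : Fin T => p).prod (seedMeasure T))
      {ω | IsUnclamped (c * M) (fun j => V (extendByZero ω.1 j)) (extendByZero ω.2) t ∧
        c * ρ * M < |⟪θ ω.1, balancingWalk (c * M) (fun j => V (extendByZero ω.1 j))
          (extendByZero ω.2) t⟫|} ≤ ENNReal.ofReal (2 * exp (-(c / 2))) := by
  have hpair : Measurable fun ω : (Fin T → Fin d → ℝ) × (Fin T → ℝ) =>
      ((fun j => V (extendByZero ω.1 j) : ℕ → E), extendByZero ω.2) := by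
    refine Measurable.prodMk (measurable_pi_lambda _ fun j => hV.comp ?_)
      ((measurable_extendByZero T).comp measurable_snd)
    exact (measurable_pi_apply j).comp ((measurable_extendByZero T).comp measurable_fst)
  refine measure_prod_le_of_section _ _ ?_ fun x =>
    seedMeasure_lt_abs_inner_le hM hc hρ (v := fun j => V (extendByZero x j)) (fun _ => hVM _)
      ht (hθ x)
  have hinner : Measurable fun ω : (Fin T → Fin d → ℝ) × (Fin T → ℝ) =>
      |⟪θ ω.1, balancingWalk (c * M) (fun j => V (extendByZero ω.1 j)) (extendByZero ω.2) t⟫| := by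
    have h := ((hθm.comp measurable_fst).inner (𝕜 := ℝ)
      ((measurable_balancingWalk (c * M) t).comp hpair)).norm
    simpa only [Real.norm_eq_abs, Function.comp_def] using h
  have hlt : MeasurableSet {ω : (Fin T → Fin d → ℝ) × (Fin T → ℝ) | c * ρ * M <
      |⟪θ ω.1, balancingWalk (c * M) (fun j => V (extendByZero ω.1 j)) (extendByZero ω.2) t⟫|} :=
    measurableSet_lt measurable_const hinner
  exact (hpair (measurableSet_isUnclamped (c * M) t)).inter hlt

lemma isUnclamped_of_forall {E : Type*} [NormedAddCommGroup E] [InnerProductSpace ℝ E]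
    {κ : ℝ} {v : ℕ → E} {u : ℕ → ℝ} {T : ℕ}
    (h : ∀ t < T, IsUnclamped κ v u t → |⟪v t, balancingWalk κ v u t⟫| ≤ κ) :
    ∀ t ≤ T, IsUnclamped κ v u t := by
  intro t
  induction t with
  | zero => exact fun _ s hs => absurd hs (Nat.not_lt_zero s)
  | succ t ih =>
    intro ht s hs
    have hG := ih (by omega)
    rcases Nat.lt_succ_iff_lt_or_eq.1 hs with h' | rfl
    · exact hG s h'
    · rw [real_inner_comm]
      exact h s (by omega) hG

/-- The failure probability of the discrepancy bound for the self-balancing walk. -/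
lemma measure_not_discrepancy_le (p : Measure (Fin d → ℝ)) [IsProbabilityMeasure p] {N L T : ℕ}
    (hN : 0 < N) (hL0 : 0 < L) (hL : N + 2 ≤ 2 ^ L) {c : ℝ} (hc : 1 ≤ c) :
    ((Measure.pi fun _ : Fin T => p).prod (seedMeasure T))
      {ω | ∀ I : Fin d → Set ℝ, (∀ i, (I i).OrdConnected) → ∀ t : Fin T,
        |∑ s ∈ Finset.Iic t, balancingSign (c * (L:ℝ) ^ d)
            (fun j => featureVec p N L (extendByZero ω.1 j)) (extendByZero ω.2) s *
          Set.indicator {x : Fin d → ℝ | ∀ i, x i ∈ I i} (fun _ => (1:ℝ)) (ω.1 s)| ≤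
            c * 2 ^ d * (L:ℝ) ^ d}ᶜ ≤
      ENNReal.ofReal (T * T * d * (1 / N) + T * (2 * exp (-(c / 2))) +
        T * ((N + 2) * (N + 2)) ^ d * (2 * exp (-(c / 2)))) := by
  set M : ℝ := (L:ℝ) ^ d with hMdef
  have hM : 0 < M := by positivity
  set P := (Measure.pi fun _ : Fin T => p).prod (seedMeasure T) with hP
  set v : (Fin T → Fin d → ℝ) → ℕ → EuclideanSpace ℝ (Fin d → Fin L × Fin (2 ^ L)) :=
    fun x j => featureVec p N L (extendByZero x j) with hv
  have hVM : ∀ y, ‖featureVec p N L y‖ ^ 2 ≤ M := fun y =>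
    (norm_featureVec_sq p (by omega) y).le
  let coll : (Fin T × Fin T) × Fin d → Set ((Fin T → Fin d → ℝ) × (Fin T → ℝ)) := fun q =>
    {x | quantileIndex (p.map fun y => y q.2) N (x q.1.1 q.2) =
      quantileIndex (p.map fun y => y q.2) N (x q.1.2 q.2) ∧ x q.1.1 q.2 < x q.1.2 q.2} ×ˢ Set.univ
  let clamp : Fin T → Set ((Fin T → Fin d → ℝ) × (Fin T → ℝ)) := fun t =>
    {ω | IsUnclamped (c * M) (v ω.1) (extendByZero ω.2) t ∧
      c * 1 * M < |⟪v ω.1 t, balancingWalk (c * M) (v ω.1) (extendByZero ω.2) t⟫|}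
  let test : Fin T × (Fin d → Fin (N + 2) × Fin (N + 2)) →
      Set ((Fin T → Fin d → ℝ) × (Fin T → ℝ)) := fun q =>
    {ω | IsUnclamped (c * M) (v ω.1) (extendByZero ω.2) (q.1 + 1) ∧
      c * 2 ^ d * M <
        |⟪boxVec L q.2, balancingWalk (c * M) (v ω.1) (extendByZero ω.2) (q.1 + 1)⟫|}
  have hcoll : ∀ q, P (coll q) ≤ ENNReal.ofReal (1 / N) := fun q => by
    rw [hP, Measure.prod_prod, measure_univ, mul_one]
    exact measure_collision_le p hN q.2 q.1.1 q.1.2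
  have hclamp : ∀ t, P (clamp t) ≤ ENNReal.ofReal (2 * exp (-(c / 2))) := fun t => by
    refine measure_lt_abs_inner_le p (measurable_featureVec p N L) hM hc one_pos hVM t.2.le
      (θ := fun x => v x t) ?_ fun x => by simpa using hVM _
    have hx : Measurable fun x : Fin T → Fin d → ℝ => extendByZero x (t : ℕ) :=
      (measurable_pi_apply (t : ℕ)).comp (measurable_extendByZero T)
    exact (measurable_featureVec p N L).comp hx
  have htest : ∀ q, P (test q) ≤ ENNReal.ofReal (2 * exp (-(c / 2))) := fun q =>
    measure_lt_abs_inner_le p (measurable_featureVec p N L) hM hc (by positivity) hVM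
      (t := q.1 + 1) q.1.2 (θ := fun _ => boxVec L q.2) measurable_const
      fun _ => norm_boxVec_sq_le L q.2
  have hsum : ∀ {ι : Type} [Fintype ι] (S : ι → Set ((Fin T → Fin d → ℝ) × (Fin T → ℝ))) (ε : ℝ),
      (∀ i, P (S i) ≤ ENNReal.ofReal ε) →
      P (⋃ i, S i) ≤ ENNReal.ofReal (Fintype.card ι * ε) := fun {ι} _ S ε h => by
    refine (measure_iUnion_fintype_le P S).trans ((Finset.sum_le_sum fun i _ => h i).trans ?_)
    rw [Finset.sum_const, nsmul_eq_mul, ENNReal.ofReal_mul (Nat.cast_nonneg _),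
      ENNReal.ofReal_natCast, Finset.card_univ]
  have h1 := hsum coll _ hcoll
  have h2 := hsum clamp _ hclamp
  have h3 := hsum test _ htest
  simp only [Fintype.card_prod, Fintype.card_fin, Fintype.card_pi, Finset.prod_const,
    Finset.card_univ, Nat.cast_mul, Nat.cast_pow, Nat.cast_add, Nat.cast_ofNat] at h1 h2 h3
  rw [ENNReal.ofReal_add (by positivity) (by positivity),
    ENNReal.ofReal_add (by positivity) (by positivity)]
  refine le_trans (measure_mono ?_) ((measure_union_le _ _).trans (add_le_add
    ((measure_union_le _ _).trans (add_le_add h1 h2)) h3))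
  intro ω hω
  by_contra hgood
  simp only [Set.mem_union, Set.mem_iUnion, not_or, not_exists] at hgood
  obtain ⟨⟨g1, g2⟩, g3⟩ := hgood
  apply hω
  have hG : ∀ t ≤ T, IsUnclamped (c * M) (v ω.1) (extendByZero ω.2) t := by
    refine isUnclamped_of_forall fun t ht hG => ?_
    by_contra! hlt
    exact g2 ⟨t, ht⟩ ⟨hG, by simpa using hlt⟩
  intro I hI t
  refine abs_sum_le_of_tests p hL ω.1 ω.2 ?_ t (fun b => ?_) I hI
  · intro i s s' h
    by_contra hne
    rcases lt_or_gt_of_ne hne with hlt | hlt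
    · exact g1 ((s, s'), i) ⟨⟨h, hlt⟩, trivial⟩
    · exact g1 ((s', s), i) ⟨⟨h.symm, hlt⟩, trivial⟩
  · by_contra! hlt
    exact g3 (t, b) ⟨hG _ t.2, hlt⟩

lemma failure_bound_le (d : ℕ) {T : ℕ} (hT : 2 ≤ T) :
    (T:ℝ) * T * d * (1 / (T ^ 3 : ℕ)) + T * (2 * exp (-(2 * (8 * d + 2) * log T / 2))) +
      T * (((T ^ 3 : ℕ) + 2) * ((T ^ 3 : ℕ) + 2)) ^ d *
        (2 * exp (-(2 * (8 * d + 2) * log T / 2))) ≤ (d + 4) / T := by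
  have hT' : (2:ℝ) ≤ T := by exact_mod_cast hT
  have hT0 : (0:ℝ) < T := by linarith
  have hexp : exp (-(2 * (8 * d + 2) * log T / 2)) = ((T:ℝ) ^ (8 * d + 2))⁻¹ := by
    rw [show -(2 * (8 * d + 2) * log T / 2) = -(((8 * d + 2 : ℕ) : ℝ) * log T) by push_cast; ring,
      exp_neg, exp_nat_mul, exp_log hT0]
  have hcube : (T:ℝ) ^ 3 + 2 ≤ T ^ 4 := by
    have : (8:ℝ) ≤ T ^ 3 := by nlinarith [sq_nonneg ((T:ℝ) - 2), mul_self_nonneg (T:ℝ)]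
    nlinarith
  have hbox : (((T:ℝ) ^ 3 + 2) * (T ^ 3 + 2)) ^ d ≤ T ^ (8 * d) := by
    calc _ ≤ ((T:ℝ) ^ 4 * T ^ 4) ^ d := by gcongr
      _ = _ := by rw [← pow_add, ← pow_mul]
  have hone : (1:ℝ) ≤ T ^ (8 * d) := one_le_pow₀ (by linarith)
  rw [hexp]
  push_cast
  set e := ((T:ℝ) ^ (8 * d + 2))⁻¹ with he
  have he0 : 0 ≤ e := by positivity
  have heT : T * T ^ (8 * d) * e = 1 / T := by rw [he]; field_simp; ring
  calc _ ≤ (T:ℝ) * T * d * (1 / T ^ 3) + T * T ^ (8 * d) * (2 * e) + T * T ^ (8 * d) * (2 * e) := by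
        have h1 : (T:ℝ) * (2 * e) ≤ T * T ^ (8 * d) * (2 * e) := by
          rw [mul_assoc]
          refine mul_le_mul_of_nonneg_left ?_ hT0.le
          exact le_mul_of_one_le_left (by positivity) hone
        have h2 : (T:ℝ) * ((T ^ 3 + 2) * (T ^ 3 + 2)) ^ d * (2 * e) ≤
            T * T ^ (8 * d) * (2 * e) := by gcongr
        linarith
    _ = (T:ℝ) * T * d * (1 / T ^ 3) + 4 * (T * T ^ (8 * d) * e) := by ring
    _ = _ := by rw [heT]; field_simp

lemma discrepancy_bound_le (d : ℕ) {T : ℕ} (hT : 2 ≤ T) :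
    2 * (8 * d + 2) * log T * 2 ^ d * ((4 * (Nat.log 2 T + 1) : ℕ) : ℝ) ^ d ≤
      8 * (16 * d + 4) * 32 ^ d * log T ^ (d + 4) := by
  have hT' : (2:ℝ) ≤ T := by exact_mod_cast hT
  have hl2 : (1:ℝ) / 2 ≤ log 2 := by linarith [log_two_gt_d9]
  have hl : log 2 ≤ log T := log_le_log (by norm_num) hT'
  have hlog : (Nat.log 2 T : ℝ) * log 2 ≤ log T := by
    rw [← log_pow]
    apply log_le_log (by positivity)
    exact_mod_cast Nat.pow_log_le_self 2 (by omega)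
  have hL : ((4 * (Nat.log 2 T + 1) : ℕ) : ℝ) ≤ 16 * log T := by
    push_cast
    have : (0:ℝ) ≤ Nat.log 2 T := Nat.cast_nonneg _
    nlinarith
  have h3 : 1 ≤ 8 * log T ^ 3 := by
    have : ((1:ℝ) / 2) ^ 3 ≤ log T ^ 3 := by gcongr; linarith
    linarith
  have hlT : 0 ≤ log T := by linarith
  calc _ ≤ 2 * (8 * d + 2) * log T * 2 ^ d * (16 * log T) ^ d := by gcongr
    _ = (16 * d + 4) * 32 ^ d * log T ^ (d + 1) * 1 := by
        rw [mul_pow, show (32:ℝ) = 2 * 16 by norm_num, mul_pow]; ring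
    _ ≤ (16 * d + 4) * 32 ^ d * log T ^ (d + 1) * (8 * log T ^ 3) := by gcongr
    _ = _ := by ring

end Main

/-- **Online Tusnády's problem for arbitrary distributions** (Theorem 1.2).  For every `d ≥ 1`
there is a constant `C_d > 0` such that for all `T ≥ 2` and every probability distribution `p`
on `[0,1]^d`, there is an online signing algorithm such that with probability at least
`1 - C_d/T`, for every axis-parallel box `B = I₁ × ⋯ × I_d` (each `I_i` an interval contained
in `[0,1]`) and every `t ≤ T`, `|∑_{s ≤ t} χ_s 1_B(x_s)| ≤ C_d (log T)^(d+4)`. -/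
theorem online_tusnady :
    ∀ d : ℕ, 1 ≤ d →
    ∃ C : ℝ, 0 < C ∧
      ∀ (T : ℕ), 2 ≤ T →
      ∀ (p : Measure (Fin d → ℝ)) [IsProbabilityMeasure p],
      (∀ᵐ x ∂p, ∀ i, x i ∈ Set.Icc (0:ℝ) 1) →
      ∃ χ : (t : Fin T) → (Fin (t.1 + 1) → (Fin d → ℝ)) → (Fin (t.1 + 1) → ℝ) → ℝ,
        (∀ t, Measurable fun q : (Fin (t.1 + 1) → (Fin d → ℝ)) × (Fin (t.1 + 1) → ℝ) =>
            χ t q.1 q.2) ∧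
        (∀ t v u, χ t v u = 1 ∨ χ t v u = -1) ∧
        ((Measure.pi fun _ : Fin T => p).prod
            (Measure.pi fun _ : Fin T => volume.restrict (Set.Icc (0:ℝ) 1)))
          {ω : (Fin T → (Fin d → ℝ)) × (Fin T → ℝ) |
            ∀ I : Fin d → Set ℝ, (∀ i, (I i).OrdConnected) → (∀ i, I i ⊆ Set.Icc (0:ℝ) 1) →
            ∀ t : Fin T,
              |∑ s ∈ Finset.Iic t,
                  χ s (fun j => ω.1 (Fin.castLE s.isLt j)) (fun j => ω.2 (Fin.castLE s.isLt j))
                    * (Set.indicator {x : Fin d → ℝ | ∀ i, x i ∈ I i} (fun _ => (1:ℝ)) (ω.1 s))|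
                ≤ C * Real.log (T : ℝ) ^ (d + 4) } ≥
          ENNReal.ofReal (1 - C / T) := by
  intro d _
  refine ⟨(d + 4) + 8 * (16 * d + 4) * 32 ^ d, by positivity, ?_⟩
  intro T hT p _ _
  have hT' : (2:ℝ) ≤ T := by exact_mod_cast hT
  set L := 4 * (Nat.log 2 T + 1) with hLdef
  set N := T ^ 3 with hNdef
  set c : ℝ := 2 * (8 * d + 2) * log T with hc
  have hlog : (1:ℝ) / 2 ≤ log T := by
    linarith [log_two_gt_d9, log_le_log (by norm_num) hT']
  have hc1 : 1 ≤ c := by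
    have : (0:ℝ) ≤ d := Nat.cast_nonneg _
    nlinarith
  have hNL : N + 2 ≤ 2 ^ L := by
    have h1 : T ^ 4 ≤ 2 ^ L := by
      rw [hLdef, mul_comm 4, pow_mul]
      exact Nat.pow_le_pow_left (Nat.lt_pow_succ_log_self (by norm_num) T).le 4
    have h2 : 2 ^ 3 ≤ T ^ 3 := Nat.pow_le_pow_left hT 3
    have h3 : T ^ 4 = T ^ 3 * T := pow_succ T 3
    have h4 : T ^ 3 * 2 ≤ T ^ 3 * T := Nat.mul_le_mul_left _ hT
    omega
  let v : (n : ℕ) → (Fin n → Fin d → ℝ) → ℕ → EuclideanSpace ℝ (Fin d → Fin L × Fin (2 ^ L)) :=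
    fun n x j => featureVec p N L (extendByZero x j)
  have hcongr : ∀ (x : Fin T → Fin d → ℝ) (u : Fin T → ℝ) (s : Fin T),
      balancingSign (c * (L:ℝ) ^ d) (v (s.1 + 1) fun j => x (Fin.castLE s.isLt j))
        (extendByZero fun j : Fin (s.1 + 1) => u (Fin.castLE s.isLt j)) s =
      balancingSign (c * (L:ℝ) ^ d) (v T x) (extendByZero u) s := by
    intro x u s
    refine balancingSign_congr (fun r hr => ?_) fun r hr => ?_
    · have h1 : r < s.1 + 1 := by omega
      have h2 : r < T := by omega
      simp [v, extendByZero, h1, h2]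
    · have h1 : r < s.1 + 1 := by omega
      have h2 : r < T := by omega
      simp [extendByZero, h1, h2]
  refine ⟨fun t x u => balancingSign (c * (L:ℝ) ^ d) (v (t.1 + 1) x) (extendByZero u) t,
    fun t => ?_, fun t x u => biasedSign_eq_or _ _ _, ?_⟩
  · refine (measurable_balancingSign (c * (L:ℝ) ^ d) t.1).comp (Measurable.prodMk
      (measurable_pi_lambda _ fun j => (measurable_featureVec p N L).comp ?_)
      ((measurable_extendByZero _).comp measurable_snd))
    exact (measurable_pi_apply j).comp ((measurable_extendByZero _).comp measurable_fst)
  · simp only [hcongr]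
    have hfail := measure_not_discrepancy_le (T := T) p (N := N) (L := L) (by positivity)
      (by omega) hNL hc1
    set P := (Measure.pi fun _ : Fin T => p).prod (seedMeasure T) with hP
    set S := {ω : (Fin T → Fin d → ℝ) × (Fin T → ℝ) |
      ∀ I : Fin d → Set ℝ, (∀ i, (I i).OrdConnected) → ∀ t : Fin T,
        |∑ s ∈ Finset.Iic t, balancingSign (c * (L:ℝ) ^ d) (v T ω.1) (extendByZero ω.2) s *
          Set.indicator {x : Fin d → ℝ | ∀ i, x i ∈ I i} (fun _ => (1:ℝ)) (ω.1 s)| ≤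
            c * 2 ^ d * (L:ℝ) ^ d} with hS
    have hsub : P S ≤ P {ω : (Fin T → Fin d → ℝ) × (Fin T → ℝ) |
        ∀ I : Fin d → Set ℝ, (∀ i, (I i).OrdConnected) → (∀ i, I i ⊆ Set.Icc (0:ℝ) 1) →
        ∀ t : Fin T,
          |∑ s ∈ Finset.Iic t, balancingSign (c * (L:ℝ) ^ d) (v T ω.1) (extendByZero ω.2) s *
            Set.indicator {x : Fin d → ℝ | ∀ i, x i ∈ I i} (fun _ => (1:ℝ)) (ω.1 s)| ≤
              ((d + 4) + 8 * (16 * d + 4) * 32 ^ d) * log T ^ (d + 4)} := by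
      refine measure_mono fun ω hω I hI _ t => (hω I hI t).trans ?_
      refine (discrepancy_bound_le d hT).trans ?_
      have : (0:ℝ) ≤ log T ^ (d + 4) := by positivity
      gcongr
      linarith [(Nat.cast_nonneg d : (0:ℝ) ≤ d)]
    refine le_trans ?_ hsub
    have hone : 1 ≤ P S + P Sᶜ := by
      rw [← measure_univ (μ := P), ← Set.union_compl_self S]
      exact measure_union_le _ _
    have hle : P Sᶜ ≤ ENNReal.ofReal (((d + 4) + 8 * (16 * d + 4) * 32 ^ d) / T) := by
      refine hfail.trans (ENNReal.ofReal_le_ofReal ((failure_bound_le d hT).trans ?_))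
      exact div_le_div_of_nonneg_right (le_add_of_nonneg_right (by positivity)) (by positivity)
    rw [ENNReal.ofReal_sub _ (by positivity), ENNReal.ofReal_one]
    exact tsub_le_iff_right.2 (hone.trans (by gcongr))
end

section
/- For every c > 0 there is a constant C > 0 (depending only on c) such that the following holds for all integers n, T ≥ 2. Let K ⊆ ℝ^n be a symmetric convex body whose standard Gaussian measure satisfies γ_n(K) ≥ 1/2, and let p be a probability distribution on ℝ^n supported on the closed Euclidean unit ball that has sub-exponential tails with constant c. Then there exists an online signing algorithm (a family of measurable maps χ_t : (ℝ^n)^t × [0,1]^t → {−1,+1}) such that, when v_1,…,v_T are i.i.d. with law p and u_1,…,u_T are independent i.i.d. uniform seeds, with probability at least 1 − C/T the discrepancy vectors d_t = Σ_{s=1}^t χ_s v_s satisfy d_t ∈ C·(log(nT))^5·K for every t ∈ {1,…,T}. -/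
open MeasureTheory Real Pointwise

namespace OnlineBanaszczyk

open ProbabilityTheory
open scoped RealInnerProductSpace ENNReal

/-- The first absolute moment of the standard Gaussian on the line. -/
noncomputable def absMean : ℝ := ∫ x, |x| ∂(gaussianReal 0 1)

lemma integrable_abs_gaussianReal : Integrable (fun x : ℝ => |x|) (gaussianReal 0 1) :=
  (IsGaussian.integrable_id (μ := gaussianReal 0 1)).abs

lemma absMean_pos : 0 < absMean := by
  have : NullSingletonClass (gaussianReal 0 1) := nullSingletonClass_gaussianReal one_ne_zero
  rw [absMean, integral_pos_iff_support_of_nonneg (fun x => abs_nonneg x)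
    integrable_abs_gaussianReal]
  have h : Function.support (fun x : ℝ => |x|) = {0}ᶜ := by
    ext x; simp
  rw [h, measure_compl (measurableSet_singleton _) (measure_ne_top _ _)]
  simp [measure_singleton]

/-- A symmetric two-point law on `±2` is dominated, in the convex order, by a Gaussian with large
enough standard deviation. -/
lemma le_lintegral_gaussianReal_of_convexOn {h : ℝ → ℝ} (hconv : ConvexOn ℝ Set.univ h)
    (hcont : Continuous h) (h0 : ∀ x, 0 ≤ h x) {κ : ℝ} (hκ : 2 ≤ κ * absMean) :
    ENNReal.ofReal ((h 2 + h (-2)) / 2) ≤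
      ∫⁻ x, ENNReal.ofReal (h (κ * x)) ∂(gaussianReal 0 1) := by
  set k : ℝ → ℝ := fun a => (h a + h (-a)) / 2 with hk
  have hκ0 : 0 < κ := by
    by_contra! hneg
    nlinarith [absMean_pos]
  have hkconv : ConvexOn ℝ Set.univ k := by
    have h1 : ConvexOn ℝ Set.univ (fun a : ℝ => h (-a)) := by
      exact (Set.preimage_univ ▸ hconv.comp_linearMap (-LinearMap.id : ℝ →ₗ[ℝ] ℝ) :)
    have h2 := (hconv.add h1).smul (c := (1 / 2 : ℝ)) (by norm_num)
    refine h2.congr ?_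
    intro x _
    simp [hk]; ring
  have hkcont : Continuous k := by fun_prop
  have hkeven : ∀ a, k |a| = k a := by
    intro a
    rcases abs_cases a with ⟨h1, _⟩ | ⟨h1, _⟩ <;> rw [h1]
    simp [hk, add_comm]
  have hk0 : ∀ a, 0 ≤ k a := fun a => by have := h0 a; have := h0 (-a); simp only [hk]; positivity
  have hsymm : ∫⁻ x, ENNReal.ofReal (h (κ * x)) ∂(gaussianReal 0 1)
      = ∫⁻ x, ENNReal.ofReal (h (-(κ * x))) ∂(gaussianReal 0 1) := by
    have h1 : (gaussianReal 0 1).map (fun x => -x) = gaussianReal 0 1 := by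
      simpa using gaussianReal_map_neg (μ := 0) (v := 1)
    conv_lhs => rw [← h1]
    rw [lintegral_map (by fun_prop) (by fun_prop)]
    simp
  have hkint : ∫⁻ x, ENNReal.ofReal (h (κ * x)) ∂(gaussianReal 0 1)
      = ∫⁻ x, ENNReal.ofReal (k (κ * x)) ∂(gaussianReal 0 1) := by
    have h1 : ∀ x, ENNReal.ofReal (k (κ * x)) =
        2⁻¹ * ENNReal.ofReal (h (κ * x)) + 2⁻¹ * ENNReal.ofReal (h (-(κ * x))) := by
      intro x
      have h2 : (2⁻¹ : ℝ≥0∞) = ENNReal.ofReal 2⁻¹ := by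
        rw [ENNReal.ofReal_inv_of_pos (by norm_num)]; simp
      rw [h2, ← ENNReal.ofReal_mul (by norm_num), ← ENNReal.ofReal_mul (by norm_num),
        ← ENNReal.ofReal_add (mul_nonneg (by norm_num) (h0 _)) (mul_nonneg (by norm_num) (h0 _))]
      congr 1
      simp only [hk]; ring
    simp_rw [h1]
    rw [lintegral_add_left (by fun_prop), lintegral_const_mul _ (by fun_prop),
      lintegral_const_mul _ (by fun_prop), ← hsymm, ← add_mul, ENNReal.inv_two_add_inv_two,
      one_mul]
  rw [hkint]
  by_cases hint : Integrable (fun x => k (κ * x)) (gaussianReal 0 1)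
  · rw [← ofReal_integral_eq_lintegral_ofReal hint (ae_of_all _ fun x => hk0 _)]
    refine ENNReal.ofReal_le_ofReal ?_
    have h1 : k (∫ x, κ * |x| ∂(gaussianReal 0 1)) ≤ ∫ x, k (κ * |x|) ∂(gaussianReal 0 1) := by
      refine hkconv.map_integral_le hkcont.continuousOn isClosed_univ (by simp)
        (integrable_abs_gaussianReal.const_mul κ) ?_
      refine hint.congr (ae_of_all _ fun x => ?_)
      simp only [Function.comp]
      rw [← hkeven (κ * x), abs_mul, abs_of_pos hκ0]
    have h2 : ∀ x, k (κ * |x|) = k (κ * x) := fun x => by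
      rw [← hkeven (κ * x), abs_mul, abs_of_pos hκ0]
    simp_rw [h2] at h1
    rw [integral_const_mul] at h1
    refine le_trans ?_ h1
    change k 2 ≤ k (κ * absMean)
    have h3 : k 2 ≤ max (k (-(κ * absMean))) (k (κ * absMean)) := by
      refine hkconv.le_max_of_mem_Icc (Set.mem_univ _) (Set.mem_univ _) ⟨?_, hκ⟩
      linarith
    have h4 : k (-(κ * absMean)) = k (κ * absMean) := by simp [hk, add_comm]
    rwa [h4, max_self] at h3
  · have : ∫⁻ x, ENNReal.ofReal (k (κ * x)) ∂(gaussianReal 0 1) = ∞ := by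
      by_contra hne
      refine hint ⟨by fun_prop, ?_⟩
      rw [hasFiniteIntegral_iff_ofReal (ae_of_all _ fun x => hk0 _)]
      exact lt_top_iff_ne_top.2 hne
    rw [this]; exact le_top

variable {E : Type*} [NormedAddCommGroup E] [InnerProductSpace ℝ E]

/-- The contraction by which the self-balancing walk acts, in mean, in direction `v`. -/
noncomputable def drift (c : ℝ) (v : E) : E →L[ℝ] E :=
  ContinuousLinearMap.id ℝ E - (c⁻¹ : ℝ) • (innerSL ℝ v).smulRight v

lemma drift_apply (c : ℝ) (v w : E) : drift c v w = w - (⟪v, w⟫ / c) • v := by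
  simp [drift, smul_smul, div_eq_inv_mul]

lemma norm_drift_sq (c : ℝ) (v w : E) :
    ‖drift c v w‖ ^ 2 = ‖w‖ ^ 2 - (2 / c - ‖v‖ ^ 2 / c ^ 2) * ⟪v, w⟫ ^ 2 := by
  rw [drift_apply, norm_sub_sq_real, inner_smul_right, norm_smul, real_inner_comm, mul_pow,
    Real.norm_eq_abs, sq_abs]
  ring

lemma inner_drift_left (c : ℝ) (v w z : E) : ⟪drift c v w, z⟫ = ⟪w, drift c v z⟫ := by
  rw [drift_apply, drift_apply, inner_sub_left, inner_sub_right, inner_smul_left, inner_smul_right]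
  simp [real_inner_comm v w]; ring

variable [FiniteDimensional ℝ E] [MeasurableSpace E] [BorelSpace E]

lemma map_drift_conv_stdGaussian (c : ℝ) (v : E) {L κ : ℝ} (hL : 0 ≤ L)
    (hκ : κ ^ 2 = L * (2 / c - ‖v‖ ^ 2 / c ^ 2)) :
    ((stdGaussian E).map (fun x => drift c v (√L • x))).conv
      ((gaussianReal 0 1).map (fun g => (κ * g) • v)) = (stdGaussian E).map (fun x => √L • x) := by
  have m1 : Measurable (fun x : E => drift c v (√L • x)) := by fun_prop
  have m2 : Measurable (fun g : ℝ => (κ * g) • v) := by fun_prop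
  have : IsProbabilityMeasure ((stdGaussian E).map (fun x => drift c v (√L • x))) :=
    Measure.isProbabilityMeasure_map m1.aemeasurable
  have : IsProbabilityMeasure ((gaussianReal 0 1).map (fun g => (κ * g) • v)) :=
    Measure.isProbabilityMeasure_map m2.aemeasurable
  have : IsProbabilityMeasure ((stdGaussian E).map (fun x => √L • x)) :=
    Measure.isProbabilityMeasure_map (by fun_prop)
  refine Measure.ext_of_charFun (funext fun t => ?_)
  rw [charFun_conv]
  have e1 : charFun ((stdGaussian E).map (fun x => drift c v (√L • x))) t
      = charFun (stdGaussian E) (√L • drift c v t) := by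
    rw [charFun_apply, charFun_apply, integral_map m1.aemeasurable (by fun_prop)]
    congr 1; ext x
    rw [inner_drift_left, inner_smul_left, inner_smul_right]; simp
  have e2 : charFun ((gaussianReal 0 1).map (fun g => (κ * g) • v)) t
      = charFun (gaussianReal 0 1) (κ * ⟪v, t⟫) := by
    rw [charFun_apply, charFun_apply_real, integral_map m2.aemeasurable (by fun_prop)]
    congr 1; ext x
    rw [inner_smul_left]; simp
    congr 1; ring
  have e3 : charFun ((stdGaussian E).map (fun x => √L • x)) t
      = charFun (stdGaussian E) (√L • t) := by
    rw [charFun_apply, charFun_apply, integral_map (by fun_prop) (by fun_prop)]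
    congr 1; ext x
    rw [inner_smul_left, inner_smul_right]; simp
  rw [e1, e2, e3, charFun_stdGaussian, charFun_stdGaussian, charFun_gaussianReal, ← Complex.exp_add]
  congr 1
  have h := norm_drift_sq c v t
  have hs : √L ^ 2 = L := Real.sq_sqrt hL
  have : -(‖√L • drift c v t‖ ^ 2 / 2) - (κ * ⟪v, t⟫) ^ 2 / 2 = -(‖√L • t‖ ^ 2 / 2) := by
    rw [norm_smul, norm_smul, mul_pow, mul_pow, mul_pow, h, hκ]
    simp [hs]; ring
  have := congrArg (fun x : ℝ => (x : ℂ)) this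
  push_cast at this ⊢
  simp only [mul_zero, zero_mul, one_mul, zero_sub]
  linear_combination this

/-- One step of the self-balancing walk keeps the Gaussian domination in the convex order. -/
lemma lintegral_drift_le {φ : E → ℝ} (hconv : ConvexOn ℝ Set.univ φ) (hcont : Continuous φ)
    (h0 : ∀ x, 0 ≤ φ x) {c : ℝ} (hc : 1 ≤ c) {v : E} (hv : ‖v‖ ≤ 1) {L : ℝ}
    (hL : L = 4 * c / absMean ^ 2) :
    ∫⁻ x, ENNReal.ofReal ((φ (drift c v (√L • x) + (2 : ℝ) • v)
        + φ (drift c v (√L • x) + (-2 : ℝ) • v)) / 2) ∂(stdGaussian E)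
      ≤ ∫⁻ x, ENNReal.ofReal (φ (√L • x)) ∂(stdGaussian E) := by
  have hm := absMean_pos
  have hL0 : 0 ≤ L := by rw [hL]; positivity
  have hv2 : ‖v‖ ^ 2 ≤ 1 := by nlinarith [norm_nonneg v]
  set a := 2 / c - ‖v‖ ^ 2 / c ^ 2 with ha
  have hca : 1 ≤ c * a := by
    have : c * a = 2 - ‖v‖ ^ 2 / c := by rw [ha]; field_simp
    have : ‖v‖ ^ 2 / c ≤ 1 := by rw [div_le_one (by linarith)]; linarith
    linarith
  have ha0 : 0 ≤ a := by
    by_contra! h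
    nlinarith
  set κ := √(L * a) with hκ
  have hκ2 : κ ^ 2 = L * a := Real.sq_sqrt (by positivity)
  have hκm : 2 ≤ κ * absMean := by
    have h1 : 4 ≤ (κ * absMean) ^ 2 := by
      rw [mul_pow, hκ2, hL]
      have : 4 * c / absMean ^ 2 * a * absMean ^ 2 = 4 * (c * a) := by field_simp
      linarith
    have : 0 ≤ κ * absMean := by positivity
    nlinarith
  have key := map_drift_conv_stdGaussian c v hL0 hκ2
  have m1 : Measurable (fun x : E => drift c v (√L • x)) := by fun_prop
  have m2 : Measurable (fun g : ℝ => (κ * g) • v) := by fun_prop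
  have : IsProbabilityMeasure ((gaussianReal 0 1).map (fun g => (κ * g) • v)) :=
    Measure.isProbabilityMeasure_map m2.aemeasurable
  have hmφ : Measurable (fun x => ENNReal.ofReal (φ x)) := by fun_prop
  have hr : ∫⁻ x, ENNReal.ofReal (φ (√L • x)) ∂(stdGaussian E)
      = ∫⁻ x, ∫⁻ g, ENNReal.ofReal (φ (drift c v (√L • x) + (κ * g) • v)) ∂(gaussianReal 0 1)
        ∂(stdGaussian E) := by
    rw [← lintegral_map (f := fun x => ENNReal.ofReal (φ x)) (g := fun x : E => √L • x) hmφ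
      (by fun_prop), ← key, Measure.lintegral_conv hmφ, lintegral_map _ m1]
    · refine lintegral_congr fun x => ?_
      rw [lintegral_map (by fun_prop) m2]
    · exact Measurable.lintegral_prod_right' (f := fun p : E × E => ENNReal.ofReal (φ (p.1 + p.2)))
        (by fun_prop)
  rw [hr]
  refine lintegral_mono fun x => ?_
  refine le_lintegral_gaussianReal_of_convexOn (h := fun s => φ (drift c v (√L • x) + s • v)) ?_
    (by fun_prop) (fun _ => h0 _) hκm
  have := hconv.comp_affineMap (AffineMap.lineMap (drift c v (√L • x)) (drift c v (√L • x) + v))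
  refine (Set.preimage_univ ▸ this).congr fun s _ => ?_
  simp [AffineMap.lineMap_apply, add_comm]

section Fernique

lemma gaussianReal_Icc_lt_half {v : NNReal} (hv : 4 < v) :
    gaussianReal 0 v (Set.Icc (-1) 1) < 2⁻¹ := by
  have hv0 : v ≠ 0 := by positivity
  have h5 : (5 : ℝ) ≤ √(2 * π * v) := by
    refine Real.le_sqrt_of_sq_le ?_
    have : (4 : ℝ) < v := by exact_mod_cast hv
    nlinarith [Real.pi_gt_d2]
  rw [gaussianReal_apply _ hv0]
  calc ∫⁻ x in Set.Icc (-1 : ℝ) 1, gaussianPDF 0 v x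
      ≤ ∫⁻ _ in Set.Icc (-1 : ℝ) 1, ENNReal.ofReal (1 / 5) := by
        refine lintegral_mono fun x => ?_
        rw [gaussianPDF]
        refine ENNReal.ofReal_le_ofReal ?_
        rw [gaussianPDFReal]
        have h1 : (√(2 * π * v))⁻¹ ≤ 1 / 5 := by
          rw [inv_eq_one_div]; gcongr
        have h2 : rexp (-(x - 0) ^ 2 / (2 * v)) ≤ 1 := by
          rw [Real.exp_le_one_iff, neg_div]
          simp only [Left.neg_nonpos_iff]
          positivity
        calc _ ≤ (1 / 5 : ℝ) * 1 := by gcongr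
          _ = _ := by norm_num
    _ = ENNReal.ofReal (2 / 5) := by
        rw [setLIntegral_const, Real.volume_Icc, ← ENNReal.ofReal_mul (by norm_num)]
        norm_num
    _ < 2⁻¹ := by
        rw [show (2⁻¹ : ℝ≥0∞) = ENNReal.ofReal (1 / 2) by
          rw [one_div, ENNReal.ofReal_inv_of_pos (by norm_num)]; simp]
        exact (ENNReal.ofReal_lt_ofReal_iff (by norm_num)).2 (by norm_num)

variable {F : Type*} [NormedAddCommGroup F] [NormedSpace ℝ F] [MeasurableSpace F] [BorelSpace F]
  [SecondCountableTopology F] [CompleteSpace F] {μ : Measure F} [IsGaussian μ]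

/-- If the unit ball has measure at least `1/2` for a centered Gaussian measure, then every
functional of norm at most one has variance at most `4`. -/
lemma variance_dual_le_four (hμ : μ[id] = 0) (h : 2⁻¹ ≤ μ {x | ‖x‖ ≤ 1}) {y : StrongDual ℝ F}
    (hy : ‖y‖ ≤ 1) : Var[y; μ] ≤ 4 := by
  by_contra! hlt
  have h0 : μ[y] = 0 := by
    rw [y.integral_comp_id_comm IsGaussian.integrable_id]
    simpa using congrArg y hμ
  have h1 := IsGaussian.map_eq_gaussianReal (μ := μ) y
  rw [h0] at h1
  have h2 : (4 : NNReal) < (Var[y; μ]).toNNReal := by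
    rw [Real.lt_toNNReal_iff_coe_lt]; simpa using hlt
  have h3 := gaussianReal_Icc_lt_half h2
  rw [← h1, Measure.map_apply (by fun_prop) measurableSet_Icc] at h3
  refine absurd (h.trans (measure_mono ?_)) (not_le.2 h3)
  intro x hx
  rw [Set.mem_preimage, Set.mem_Icc, ← abs_le, ← Real.norm_eq_abs]
  have hx' : ‖x‖ ≤ 1 := hx
  calc ‖y x‖ ≤ ‖y‖ * ‖x‖ := y.le_opNorm x
    _ ≤ 1 * 1 := by gcongr
    _ = 1 := one_mul 1

/-- A zero-one type gap: if the unit ball has measure at least `1/2` for a centered Gaussian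
measure, then the ball of radius `16` has measure at least `9/16`. -/
lemma le_measure_norm_le_sixteen (hμ : μ[id] = 0) (h : 2⁻¹ ≤ μ {x | ‖x‖ ≤ 1}) :
    ENNReal.ofReal (9 / 16) ≤ μ {x | ‖x‖ ≤ 16} := by
  have ms : ∀ r : ℝ, MeasurableSet {x : F | ‖x‖ ≤ r} := fun r =>
    measurableSet_le measurable_norm measurable_const
  have ms' : ∀ r : ℝ, MeasurableSet {x : F | r < ‖x‖} := fun r =>
    measurableSet_lt measurable_const measurable_norm
  have hrot := IsGaussian.map_rotation_eq_self hμ (-(π / 4))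
  set S : Set (F × F) := {x | ‖x.1‖ ≤ 1} ∩ {x | 16 < ‖x.2‖} with hS
  have mS : MeasurableSet S :=
    (measurableSet_le (by fun_prop) (by fun_prop)).inter
      (measurableSet_lt (by fun_prop) (by fun_prop))
  have hSprod : (μ.prod μ) S = μ {x | ‖x‖ ≤ 1} * μ {x | 16 < ‖x‖} := by
    rw [← Measure.prod_prod]; rfl
  set R : Set (F × F) := ContinuousLinearMap.rotation (-(π / 4)) ⁻¹' S with hR
  have hSR : (μ.prod μ) S = (μ.prod μ) R := by
    conv_lhs => rw [← hrot]
    rw [Measure.map_apply (by fun_prop) mS]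
  have mR : MeasurableSet R := by
    exact (ContinuousLinearMap.rotation (-(π / 4))).continuous.measurable mS
  set A : Set F := {x | 1 < ‖x‖} ∩ {x | ‖x‖ ≤ 16} with hA
  have mA : MeasurableSet A := (ms' _).inter (ms _)
  have hsec : ∀ z : F, μ (Prod.mk z ⁻¹' R) ≤ A.indicator 1 z + ENNReal.ofReal (1 / 32) := by
    intro z
    have hmem : ∀ w, w ∈ Prod.mk z ⁻¹' R → ‖z - w‖ ≤ √2 ∧ 16 * √2 < ‖z + w‖ := by
      intro w hw
      obtain ⟨h1, h2⟩ : ‖(ContinuousLinearMap.rotation (-(π / 4)) (z, w)).1‖ ≤ 1 ∧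
        16 < ‖(ContinuousLinearMap.rotation (-(π / 4)) (z, w)).2‖ := hw
      simp only [ContinuousLinearMap.rotation_apply, Real.cos_neg,
        Real.cos_pi_div_four, Real.sin_neg, Real.sin_pi_div_four, neg_smul, neg_neg,
        ← sub_eq_add_neg, ← smul_sub, ← smul_add, norm_smul, Real.norm_eq_abs] at h1 h2
      rw [abs_of_nonneg (by positivity)] at h1 h2
      have h3 : √2 * √2 = 2 := Real.mul_self_sqrt (by norm_num)
      have h4 : 0 < √2 := by positivity
      constructor
      · nlinarith
      · nlinarith
    have hs1 : √2 < 1.42 := by rw [Real.sqrt_lt' (by norm_num)]; norm_num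
    have hs2 : 1.41 < √2 := by rw [Real.lt_sqrt (by norm_num)]; norm_num
    by_cases hzA : z ∈ A
    · rw [Set.indicator_of_mem hzA]
      exact prob_le_one.trans (by simp)
    rw [Set.indicator_of_notMem hzA, zero_add]
    rcases le_or_gt ‖z‖ 1 with hz | hz
    · have : Prod.mk z ⁻¹' R = ∅ := by
        refine Set.eq_empty_of_forall_notMem fun w hw => ?_
        obtain ⟨h1, h2⟩ := hmem w hw
        have h3 : ‖z + w‖ ≤ ‖z‖ + ‖z‖ + ‖z - w‖ := by
          calc ‖z + w‖ = ‖z + z - (z - w)‖ := by congr 1; abel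
            _ ≤ ‖z + z‖ + ‖z - w‖ := norm_sub_le _ _
            _ ≤ _ := by gcongr; exact norm_add_le _ _
        linarith
      simp [this]
    · have hz16 : 16 < ‖z‖ := by
        by_contra! h16
        exact hzA ⟨hz, h16⟩
      obtain ⟨y, hy, hyz⟩ := exists_dual_vector'' ℝ z
      have h0 : μ[y] = 0 := by
        rw [y.integral_comp_id_comm IsGaussian.integrable_id]
        simpa using congrArg y hμ
      have hcheb := meas_ge_le_variance_div_sq (IsGaussian.memLp_dual μ y 2 (by simp)) (c := 14)
        (by norm_num)
      rw [h0] at hcheb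
      refine (measure_mono ?_).trans (hcheb.trans (ENNReal.ofReal_le_ofReal ?_))
      · intro w hw
        obtain ⟨h1, -⟩ := hmem w hw
        have h2 : y (z - w) ≤ √2 := by
          calc y (z - w) ≤ ‖y (z - w)‖ := Real.le_norm_self _
            _ ≤ ‖y‖ * ‖z - w‖ := y.le_opNorm _
            _ ≤ 1 * √2 := by gcongr
            _ = √2 := one_mul _
        rw [map_sub, hyz] at h2
        change 14 ≤ |y w - 0|
        rw [sub_zero]
        refine le_trans ?_ (le_abs_self _)
        simp only [RCLike.ofReal_real_eq_id, id] at h2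
        linarith
      · have := variance_dual_le_four hμ h hy
        rw [div_le_iff₀ (by norm_num)]
        linarith
  have hRle : (μ.prod μ) R ≤ μ A + ENNReal.ofReal (1 / 32) := by
    rw [Measure.prod_apply mR]
    calc _ ≤ ∫⁻ z, (A.indicator 1 z + ENNReal.ofReal (1 / 32)) ∂μ := lintegral_mono hsec
      _ = _ := by
        rw [lintegral_add_right _ measurable_const, lintegral_indicator_one mA]
        simp
  rw [← hSR, hSprod] at hRle
  have hsum : μ {x | ‖x‖ ≤ 16} = μ {x | ‖x‖ ≤ 1} + μ A := by
    rw [← measure_union _ mA]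
    · congr 1
      ext x
      simp only [hA, Set.mem_union, Set.mem_inter_iff, Set.mem_ofPred_eq]
      constructor
      · intro hx
        rcases le_or_gt ‖x‖ 1 with h1 | h1
        · exact Or.inl h1
        · exact Or.inr ⟨h1, hx⟩
      · rintro (h1 | h1)
        · linarith
        · exact h1.2
    · rw [Set.disjoint_left]
      intro x hx hx'
      exact (not_lt.2 (show ‖x‖ ≤ 1 from hx)) hx'.1
  have hcompl : μ {x | 16 < ‖x‖} = 1 - μ {x | ‖x‖ ≤ 16} := by
    rw [← prob_compl_eq_one_sub (ms 16)]
    congr 1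
    ext x
    simp
  have e1 : (2⁻¹ : ℝ≥0∞) = ENNReal.ofReal (1 / 2) := by
    rw [one_div, ENNReal.ofReal_inv_of_pos (by norm_num)]; simp
  rw [hcompl] at hRle
  lift μ {x | ‖x‖ ≤ 1} to NNReal using measure_ne_top _ _ with a ha
  lift μ A to NNReal using measure_ne_top _ _ with b hb
  have hle1 : μ {x | ‖x‖ ≤ 16} ≤ 1 := prob_le_one
  rw [hsum] at hRle hle1 ⊢
  norm_cast at hle1
  have h1 : (1 / 2 : ℝ) ≤ a := by
    rw [e1, ENNReal.ofReal_le_iff_le_toReal (by simp)] at h; simpa using h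
  have h2 : (a : ℝ) * (1 - (a + b)) ≤ b + 1 / 32 := by
    have := ENNReal.toReal_mono (by simp) hRle
    rw [ENNReal.toReal_mul, ENNReal.toReal_add (by simp) (by simp),
      ENNReal.toReal_sub_of_le (by exact_mod_cast hle1) (by simp)] at this
    rw [ENNReal.toReal_add (by simp) (by simp)] at this
    simpa using this
  have hle1' : (a : ℝ) + b ≤ 1 := by exact_mod_cast hle1
  rw [ENNReal.ofReal_le_iff_le_toReal (by simp), ENNReal.toReal_add (by simp) (by simp)]
  simp only [ENNReal.coe_toReal]
  by_contra! hlt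
  nlinarith [b.coe_nonneg]

/-- An exponential moment bound, with an absolute constant, for the norm under a centered Gaussian
measure for which the unit ball has measure at least `1/2`. -/
theorem exists_lintegral_exp_norm_le : ∃ M : ℝ, 0 < M ∧
    ∀ {F : Type} [NormedAddCommGroup F] [NormedSpace ℝ F] [MeasurableSpace F] [BorelSpace F]
      [SecondCountableTopology F] [CompleteSpace F] {μ : Measure F} [IsGaussian μ],
      μ[id] = 0 → 2⁻¹ ≤ μ {x | ‖x‖ ≤ 1} →
      ∫⁻ x, ENNReal.ofReal (rexp ‖x‖) ∂μ ≤ ENNReal.ofReal M := by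
  set q : ℝ≥0∞ := ENNReal.ofReal (9 / 16) with hq
  have hq2 : 2⁻¹ < q := by
    rw [show (2⁻¹ : ℝ≥0∞) = ENNReal.ofReal (1 / 2) by
      rw [one_div, ENNReal.ofReal_inv_of_pos (by norm_num)]; simp]
    exact (ENNReal.ofReal_lt_ofReal_iff (by norm_num)).2 (by norm_num)
  have hq1 : q < 1 := by
    rw [hq, ← ENNReal.ofReal_one]
    exact (ENNReal.ofReal_lt_ofReal_iff (by norm_num)).2 (by norm_num)
  have hκ := Fernique.logRatio_pos hq2 hq1
  set κ : ℝ := Fernique.logRatio q * (16 : ℝ)⁻¹ ^ 2 with hκdef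
  have hκ0 : 0 < κ := by positivity
  set B : ℝ≥0∞ := ENNReal.ofReal (rexp (Fernique.logRatio q))
        + ∑' n : ℕ, ENNReal.ofReal (rexp (-2⁻¹ * Real.log (q / (1 - q)).toReal * 2 ^ n)) with hB
  have hBtop : B < ⊤ := by
    refine ENNReal.add_lt_top.mpr ⟨ENNReal.ofReal_lt_top, ?_⟩
    refine Summable.tsum_ofReal_lt_top <|
      Real.summable_exp_nat_mul_of_ge ?_ (fun i ↦ mod_cast (Nat.lt_pow_self (by simp)).le)
    refine mul_neg_of_neg_of_pos (by simp) (Real.log_pos ?_)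
    rw [ENNReal.toReal_div, ENNReal.toReal_sub_of_le hq1.le (by simp), hq,
      ENNReal.toReal_ofReal (by norm_num)]
    norm_num
  refine ⟨rexp (1 / (4 * κ)) * B.toReal + 1, by positivity, ?_⟩
  intro F _ _ _ _ _ _ μ _ hμ h
  have h1 := lintegral_exp_mul_sq_norm_le_of_map_rotation_eq_self
    (IsGaussian.map_rotation_eq_self hμ (-(π / 4))) (le_measure_norm_le_sixteen hμ h) hq2
  calc ∫⁻ x, ENNReal.ofReal (rexp ‖x‖) ∂μ
      ≤ ∫⁻ x, ENNReal.ofReal (rexp (1 / (4 * κ))) * ENNReal.ofReal (rexp (κ * ‖x‖ ^ 2)) ∂μ := by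
        refine lintegral_mono fun x => ?_
        rw [← ENNReal.ofReal_mul (by positivity), ← Real.exp_add]
        refine ENNReal.ofReal_le_ofReal (Real.exp_le_exp.2 ?_)
        have : 1 / (4 * κ) + κ * ‖x‖ ^ 2 - ‖x‖ = (2 * κ * ‖x‖ - 1) ^ 2 / (4 * κ) := by
          field_simp; ring
        have h2 : 0 ≤ (2 * κ * ‖x‖ - 1) ^ 2 / (4 * κ) := by positivity
        linarith
    _ = ENNReal.ofReal (rexp (1 / (4 * κ))) * ∫⁻ x, ENNReal.ofReal (rexp (κ * ‖x‖ ^ 2)) ∂μ :=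
        lintegral_const_mul _ (by fun_prop)
    _ ≤ ENNReal.ofReal (rexp (1 / (4 * κ))) * B := by gcongr
    _ = ENNReal.ofReal (rexp (1 / (4 * κ)) * B.toReal) := by
        rw [ENNReal.ofReal_mul (by positivity), ENNReal.ofReal_toReal hBtop.ne]
    _ ≤ _ := ENNReal.ofReal_le_ofReal (by linarith)

end Fernique

section SeminormSpace

/-- A type synonym for a real vector space, to be equipped with the norm given by a seminorm. -/
def SeminormSpace {E : Type} [AddCommGroup E] [Module ℝ E] (_ : Seminorm ℝ E) : Type := E

variable {E : Type} [NormedAddCommGroup E] [InnerProductSpace ℝ E] [FiniteDimensional ℝ E]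
  [MeasurableSpace E] [BorelSpace E]

instance (s : Seminorm ℝ E) : AddCommGroup (SeminormSpace s) := inferInstanceAs (AddCommGroup E)

instance (s : Seminorm ℝ E) : Module ℝ (SeminormSpace s) := inferInstanceAs (Module ℝ E)

/-- The identity, as a linear equivalence onto the type synonym. -/
def toSeminormSpace (s : Seminorm ℝ E) : E ≃ₗ[ℝ] SeminormSpace s := LinearEquiv.refl ℝ E

/-- An exponential moment bound, with an absolute constant, for a norm under the standard Gaussian
measure. -/
theorem exists_lintegral_exp_seminorm_le : ∃ M : ℝ, 0 < M ∧
    ∀ {E : Type} [NormedAddCommGroup E] [InnerProductSpace ℝ E] [FiniteDimensional ℝ E]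
      [MeasurableSpace E] [BorelSpace E] (s : Seminorm ℝ E), (∀ x, s x = 0 → x = 0) →
      2⁻¹ ≤ stdGaussian E {x | s x ≤ 1} →
      ∫⁻ x, ENNReal.ofReal (rexp (s x)) ∂(stdGaussian E) ≤ ENNReal.ofReal M := by
  obtain ⟨M, hM, h⟩ := exists_lintegral_exp_norm_le
  refine ⟨M, hM, ?_⟩
  intro E _ _ _ _ _ s hs hK
  let nF : Norm (SeminormSpace s) := ⟨fun x => s ((toSeminormSpace s).symm x)⟩
  have core : NormedSpace.Core ℝ (SeminormSpace s) :=
    { norm_nonneg := fun x => apply_nonneg s _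
      norm_smul := fun c x => map_smul_eq_mul s c _
      norm_triangle := fun x y => map_add_le_add s _ _
      norm_eq_zero_iff := fun x => ⟨fun hx => hs _ hx, fun hx => by
        subst hx; exact map_zero s⟩ }
  let iF : NormedAddCommGroup (SeminormSpace s) := NormedAddCommGroup.ofCore core
  let : NormedSpace ℝ (SeminormSpace s) := NormedSpace.ofCore core
  let : MeasurableSpace (SeminormSpace s) := borel _
  have : BorelSpace (SeminormSpace s) := ⟨rfl⟩
  have : FiniteDimensional ℝ (SeminormSpace s) := (toSeminormSpace s).finiteDimensional
  have : CompleteSpace (SeminormSpace s) := FiniteDimensional.complete ℝ _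
  have : ProperSpace (SeminormSpace s) := FiniteDimensional.proper ℝ _
  let e : E ≃L[ℝ] SeminormSpace s := (toSeminormSpace s).toContinuousLinearEquiv
  have he : ∀ x, ‖e x‖ = s x := fun x => rfl
  have h1 := h (μ := (stdGaussian E).map e) ?_ ?_
  · rw [lintegral_map (by fun_prop) (by fun_prop)] at h1
    simpa only [he] using h1
  · have : ∫ x, e x ∂(stdGaussian E) = 0 := by
      rw [e.integral_comp_comm, integral_id_stdGaussian, map_zero]
    rw [integral_map (by fun_prop) (by fun_prop)]
    simpa using this
  · rw [Measure.map_apply (by fun_prop) (measurableSet_le (by fun_prop) (by fun_prop))]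
    exact hK

end SeminormSpace

/-- The sign of the self-balancing walk, as a function of the current correlation `x` and the
seed `u`. -/
noncomputable def balancingSign (c x u : ℝ) : ℝ := if u ≤ 1 / 2 - x / (2 * c) then 1 else -1

lemma balancingSign_eq (c x u : ℝ) : balancingSign c x u = 1 ∨ balancingSign c x u = -1 := by
  unfold balancingSign; split_ifs <;> simp

/-- Extend a finite sequence by zero. -/
def extendZero {α : Type*} [Zero α] {m : ℕ} (f : Fin m → α) (k : ℕ) : α :=
  if h : k < m then f ⟨k, h⟩ else 0

lemma extendZero_update {α : Type*} [Zero α] {m : ℕ} (f : Fin m → α) (i : Fin m) (a : α) :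
    extendZero (Function.update f i a) = Function.update (extendZero f) i a := by
  ext k
  by_cases hk : k = i
  · subst hk; simp [extendZero]
  · rw [Function.update_of_ne hk]
    simp only [extendZero]
    split_ifs with h
    · rw [Function.update_of_ne]
      rintro rfl; exact hk rfl
    · rfl

lemma measurable_extendZero {α : Type*} [Zero α] [MeasurableSpace α] {m : ℕ} (k : ℕ) :
    Measurable fun f : Fin m → α => extendZero f k := by
  simp only [extendZero]
  split_ifs with h <;> fun_prop

/-- Fubini in a single coordinate of a product of probability measures. -/
lemma lintegral_pi_eq_lintegral_update {ι : Type*} [Fintype ι] [DecidableEq ι] {X : ι → Type*}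
    [∀ i, MeasurableSpace (X i)] (μ : ∀ i, Measure (X i)) [∀ i, IsProbabilityMeasure (μ i)]
    {f : (∀ i, X i) → ℝ≥0∞} (hf : Measurable f) (i : ι) :
    ∫⁻ u, f u ∂Measure.pi μ =
      ∫⁻ u, ∫⁻ x, f (Function.update u i x) ∂μ i ∂Measure.pi μ := by
  set g : (∀ i, X i) → ℝ≥0∞ := fun u => ∫⁻ x, f (Function.update u i x) ∂μ i with hg
  have hgm : Measurable g := by
    refine Measurable.lintegral_prod_right' (f := fun p : (∀ i, X i) × X i =>
      f (Function.update p.1 i p.2)) (hf.comp ?_)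
    exact measurable_update'
  have hu : Nonempty (∀ i, X i) := ⟨fun i => (nonempty_of_isProbabilityMeasure (μ i)).some⟩
  obtain ⟨u₀⟩ := hu
  have h1 := congrFun (lmarginal_erase' (μ := μ) f hf (Finset.mem_univ i)) u₀
  have h2 := congrFun (lmarginal_erase' (μ := μ) g hgm (Finset.mem_univ i)) u₀
  simp only [lmarginal_univ] at h1 h2
  rw [h1, h2]
  congr 2
  ext u
  simp [hg]

section Walk

variable {E : Type*} [NormedAddCommGroup E] [InnerProductSpace ℝ E]

/-- The self-balancing walk with threshold `c`, inputs `v` and seeds `u`. -/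
noncomputable def walk (c : ℝ) (v : ℕ → E) (u : ℕ → ℝ) : ℕ → E
  | 0 => 0
  | t + 1 => walk c v u t + balancingSign c ⟪v t, walk c v u t⟫ (u t) • v t

/-- The walk has never exceeded the threshold before time `t`. -/
def Good (c : ℝ) (v : ℕ → E) (u : ℕ → ℝ) (t : ℕ) : Prop :=
  ∀ s < t, |⟪v s, walk c v u s⟫| ≤ c

lemma walk_congr {c : ℝ} {v v' : ℕ → E} {u u' : ℕ → ℝ} {t : ℕ} (hv : ∀ s < t, v s = v' s)
    (hu : ∀ s < t, u s = u' s) : walk c v u t = walk c v' u' t := by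
  induction t with
  | zero => rfl
  | succ t ih =>
    rw [walk, walk, ih (fun s hs => hv s (by omega)) (fun s hs => hu s (by omega)),
      hv t (by omega), hu t (by omega)]

lemma walk_update {c : ℝ} {v : ℕ → E} {u : ℕ → ℝ} {s t : ℕ} (hst : s ≤ t) (x : ℝ) :
    walk c v (Function.update u t x) s = walk c v u s :=
  walk_congr (fun _ _ => rfl) fun r hr => Function.update_of_ne (by omega) _ _

lemma good_succ_update {c : ℝ} {v : ℕ → E} {u : ℕ → ℝ} {t : ℕ} (x : ℝ) :
    Good c v (Function.update u t x) (t + 1) ↔ Good c v u t ∧ |⟪v t, walk c v u t⟫| ≤ c := by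
  constructor
  · intro h
    refine ⟨fun s hs => ?_, ?_⟩
    · have := h s (by omega); rwa [walk_update (by omega)] at this
    · have := h t (by omega); rwa [walk_update le_rfl] at this
  · rintro ⟨h1, h2⟩ s hs
    rw [walk_update (by omega)]
    rcases Nat.lt_succ_iff_lt_or_eq.1 hs with h | rfl
    · exact h1 s h
    · exact h2

lemma good_succ {c : ℝ} {v : ℕ → E} {u : ℕ → ℝ} {t : ℕ} :
    Good c v u (t + 1) ↔ Good c v u t ∧ |⟪v t, walk c v u t⟫| ≤ c := by
  simpa using good_succ_update (c := c) (v := v) (u := u) (t := t) (u t)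

/-- The chord bound for a convex function between `w - 2 v` and `w + 2 v`. -/
lemma convexOn_chord {φ : E → ℝ} (hconv : ConvexOn ℝ Set.univ φ) (w v : E) {s : ℝ}
    (hs : |s| ≤ 2) :
    φ (w + s • v) ≤ (2 + s) / 4 * φ (w + (2 : ℝ) • v) + (2 - s) / 4 * φ (w + (-2 : ℝ) • v) := by
  obtain ⟨h1, h2⟩ := abs_le.1 hs
  have := hconv.2 (Set.mem_univ (w + (2 : ℝ) • v)) (Set.mem_univ (w + (-2 : ℝ) • v))
    (show 0 ≤ (2 + s) / 4 by linarith) (show 0 ≤ (2 - s) / 4 by linarith) (by ring)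
  simp only [smul_eq_mul] at this
  have e : w + s • v = ((2 + s) / 4) • (w + (2 : ℝ) • v) + ((2 - s) / 4) • (w + (-2 : ℝ) • v) := by
    module
  rw [e]
  exact this

lemma lintegral_step_le {φ : E → ℝ} (hconv : ConvexOn ℝ Set.univ φ)
    (h0 : ∀ x, 0 ≤ φ x) {c : ℝ} (hc : 0 < c) {v w : E} (hw : |⟪v, w⟫| ≤ c) :
    ∫⁻ x in Set.Icc (0 : ℝ) 1, ENNReal.ofReal (φ (w + balancingSign c ⟪v, w⟫ x • v)) ≤
      ENNReal.ofReal ((φ (drift c v w + (2 : ℝ) • v) + φ (drift c v w + (-2 : ℝ) • v)) / 2) := by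
  set a := ⟪v, w⟫ / c with ha
  have ha1 : |a| ≤ 1 := by rw [ha, abs_div, abs_of_pos hc, div_le_one hc]; exact hw
  obtain ⟨hal, hau⟩ := abs_le.1 ha1
  set q : ℝ := 1 / 2 - a / 2 with hq
  have hsign : ∀ x, balancingSign c ⟪v, w⟫ x = if x ≤ q then 1 else -1 := by
    intro x
    rw [balancingSign, hq, ha, div_div, mul_comm c 2]
  have hsplit : Set.Icc (0 : ℝ) 1 = Set.Icc 0 q ∪ Set.Ioc q 1 :=
    (Set.Icc_union_Ioc_eq_Icc (by linarith) (by linarith)).symm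
  rw [hsplit, lintegral_union measurableSet_Ioc
    (Set.disjoint_left.2 fun x hx hx' => absurd hx.2 (not_le.2 hx'.1))]
  have i1 : ∫⁻ x in Set.Icc 0 q, ENNReal.ofReal (φ (w + balancingSign c ⟪v, w⟫ x • v))
      = ENNReal.ofReal (q * φ (w + v)) := by
    rw [setLIntegral_congr_fun (g := fun _ => ENNReal.ofReal (φ (w + v))) measurableSet_Icc]
    · rw [setLIntegral_const, Real.volume_Icc, mul_comm, ← ENNReal.ofReal_mul (by linarith)]
      simp
    · intro x hx
      simp [hsign, hx.2]
  have i2 : ∫⁻ x in Set.Ioc q 1, ENNReal.ofReal (φ (w + balancingSign c ⟪v, w⟫ x • v))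
      = ENNReal.ofReal ((1 - q) * φ (w - v)) := by
    rw [setLIntegral_congr_fun (g := fun _ => ENNReal.ofReal (φ (w - v))) measurableSet_Ioc]
    · rw [setLIntegral_const, Real.volume_Ioc, mul_comm, ← ENNReal.ofReal_mul (by linarith)]
    · intro x hx
      simp [hsign, not_le.2 hx.1, sub_eq_add_neg]
  rw [i1, i2, ← ENNReal.ofReal_add (mul_nonneg (by linarith) (h0 _))
    (mul_nonneg (by linarith) (h0 _))]
  refine ENNReal.ofReal_le_ofReal ?_
  have hd : w = drift c v w + a • v := by rw [drift_apply, ha]; module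
  have c1 := convexOn_chord hconv (drift c v w) v (s := 1 + a) (abs_le.2 ⟨by linarith, by linarith⟩)
  have c2 := convexOn_chord hconv (drift c v w) v (s := a - 1) (abs_le.2 ⟨by linarith, by linarith⟩)
  have e1 : drift c v w + (1 + a) • v = w + v := by
    conv_rhs => rw [hd]
    module
  have e2 : drift c v w + (a - 1) • v = w - v := by
    conv_rhs => rw [hd]
    module
  rw [e1] at c1
  rw [e2] at c2
  have c1' := mul_le_mul_of_nonneg_left c1 (show 0 ≤ q by linarith)
  have c2' := mul_le_mul_of_nonneg_left c2 (show 0 ≤ 1 - q by linarith)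
  refine (add_le_add c1' c2').trans (le_of_eq ?_)
  rw [hq]; ring

variable [FiniteDimensional ℝ E] [MeasurableSpace E] [BorelSpace E]

lemma measurable_walk {α : Type*} [MeasurableSpace α] (c : ℝ) {v : α → ℕ → E} {u : α → ℕ → ℝ}
    (t : ℕ) (hv : ∀ s, Measurable fun a => v a s) (hu : ∀ s, Measurable fun a => u a s) :
    Measurable fun a => walk c (v a) (u a) t := by
  induction t with
  | zero => simp only [walk]; fun_prop
  | succ t ih =>
    have h1 := hv t
    have h2 := hu t
    simp only [walk, balancingSign]
    refine ih.add (Measurable.smul (Measurable.ite ?_ measurable_const measurable_const) h1)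
    exact measurableSet_le h2 (by fun_prop)

lemma measurableSet_good {α : Type*} [MeasurableSpace α] (c : ℝ) {v : α → ℕ → E}
    {u : α → ℕ → ℝ} (t : ℕ) (hv : ∀ s, Measurable fun a => v a s)
    (hu : ∀ s, Measurable fun a => u a s) : MeasurableSet {a | Good c (v a) (u a) t} := by
  have : {a | Good c (v a) (u a) t} =
      ⋂ s : Fin t, {a | |⟪v a s, walk c (v a) (u a) s⟫| ≤ c} := by
    ext a; simp [Good, Fin.forall_iff]
  rw [this]
  refine MeasurableSet.iInter fun s => measurableSet_le ?_ measurable_const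
  have := hv s
  have := measurable_walk c (v := v) (u := u) s hv hu
  fun_prop

lemma stdGaussian_map_neg : (stdGaussian E).map (fun x => -x) = stdGaussian E :=
  stdGaussian_map (LinearIsometryEquiv.neg ℝ (E := E))

lemma ofReal_zero_le_lintegral_stdGaussian {φ : E → ℝ} (hconv : ConvexOn ℝ Set.univ φ)
    (hcont : Continuous φ) (h0 : ∀ x, 0 ≤ φ x) (r : ℝ) :
    ENNReal.ofReal (φ 0) ≤ ∫⁻ x, ENNReal.ofReal (φ (r • x)) ∂(stdGaussian E) := by
  have hsymm : ∫⁻ x, ENNReal.ofReal (φ (r • x)) ∂(stdGaussian E)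
      = ∫⁻ x, ENNReal.ofReal (φ (r • -x)) ∂(stdGaussian E) := by
    conv_lhs => rw [← stdGaussian_map_neg]
    rw [lintegral_map (by fun_prop) (by fun_prop)]
  have h1 : ENNReal.ofReal (2 * φ 0) ≤ 2 * ∫⁻ x, ENNReal.ofReal (φ (r • x)) ∂(stdGaussian E) := by
    calc ENNReal.ofReal (2 * φ 0) = ∫⁻ _, ENNReal.ofReal (2 * φ 0) ∂(stdGaussian E) := by simp
      _ ≤ ∫⁻ x, (ENNReal.ofReal (φ (r • x)) + ENNReal.ofReal (φ (r • -x))) ∂(stdGaussian E) := by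
        refine lintegral_mono fun x => ?_
        rw [← ENNReal.ofReal_add (h0 _) (h0 _)]
        refine ENNReal.ofReal_le_ofReal ?_
        have := hconv.2 (Set.mem_univ (r • x)) (Set.mem_univ (r • -x))
          (show (0 : ℝ) ≤ 1 / 2 by norm_num) (show (0 : ℝ) ≤ 1 / 2 by norm_num) (by norm_num)
        simp only [smul_neg, smul_eq_mul, add_neg_cancel] at this ⊢
        linarith
      _ = _ := by rw [lintegral_add_left (by fun_prop), ← hsymm, two_mul]
  rw [ENNReal.ofReal_mul (by norm_num)] at h1
  rw [ENNReal.ofReal_ofNat] at h1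
  exact (ENNReal.mul_le_mul_iff_right two_ne_zero ENNReal.ofNat_ne_top).1 h1

/-- The self-balancing walk, killed when it crosses the threshold, is dominated by a Gaussian of
covariance `L` in the convex order. -/
theorem lintegral_walk_le {T : ℕ} {c : ℝ} (hc : 1 ≤ c) {v : ℕ → E} (hv : ∀ s, ‖v s‖ ≤ 1) {L : ℝ}
    (hL : L = 4 * c / absMean ^ 2) {t : ℕ} (ht : t ≤ T) {φ : E → ℝ}
    (hconv : ConvexOn ℝ Set.univ φ) (hcont : Continuous φ) (h0 : ∀ x, 0 ≤ φ x) :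
    ∫⁻ u, {u | Good c v (extendZero u) t}.indicator
        (fun u => ENNReal.ofReal (φ (walk c v (extendZero u) t))) u
        ∂(Measure.pi fun _ : Fin T => volume.restrict (Set.Icc (0 : ℝ) 1))
      ≤ ∫⁻ x, ENNReal.ofReal (φ (√L • x)) ∂(stdGaussian E) := by
  have hp : IsProbabilityMeasure (volume.restrict (Set.Icc (0 : ℝ) 1)) := ⟨by simp⟩
  have mw : ∀ t, Measurable fun u : Fin T → ℝ => walk c v (extendZero u) t := fun t =>
    measurable_walk c t (fun _ => measurable_const) measurable_extendZero
  have mg : ∀ t, MeasurableSet {u : Fin T → ℝ | Good c v (extendZero u) t} := fun t =>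
    measurableSet_good c t (fun _ => measurable_const) measurable_extendZero
  induction t generalizing φ with
  | zero =>
    simp only [Good, walk, Nat.not_lt_zero, false_imp_iff, implies_true, Set.ofPred_true,
      Set.indicator_univ, lintegral_const, measure_univ, mul_one]
    exact ofReal_zero_le_lintegral_stdGaussian hconv hcont h0 _
  | succ t ih =>
    rw [lintegral_pi_eq_lintegral_update _ _ (⟨t, ht⟩ : Fin T)]
    swap
    · exact (by have := mw (t + 1); fun_prop : Measurable _).indicator (mg _)
    set ψ : E → ℝ := fun w =>
      (φ (drift c (v t) w + (2 : ℝ) • v t) + φ (drift c (v t) w + (-2 : ℝ) • v t)) / 2 with hψ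
    have hpart : ∀ b : E, ConvexOn ℝ Set.univ fun w => φ (drift c (v t) w + b) := fun b => by
      have := (hconv.translate_left b).comp_linearMap (drift c (v t)).toLinearMap
      simpa [Function.comp_def] using this
    have ψconv : ConvexOn ℝ Set.univ ψ := by
      refine (((hpart ((2 : ℝ) • v t)).add (hpart ((-2 : ℝ) • v t))).smul (c := (1 / 2 : ℝ))
        (by norm_num)).congr fun x _ => ?_
      simp [hψ]; ring
    have ψ0 : ∀ w, 0 ≤ ψ w := fun w => by
      have := h0 (drift c (v t) w + (2 : ℝ) • v t)
      have := h0 (drift c (v t) w + (-2 : ℝ) • v t)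
      simp only [hψ]; positivity
    refine le_trans ?_ ((ih (by omega) ψconv (by fun_prop) ψ0).trans
      (lintegral_drift_le hconv hcont h0 hc (hv t) hL))
    refine lintegral_mono fun u => ?_
    have hmem : ∀ x, Function.update u ⟨t, ht⟩ x ∈ {u | Good c v (extendZero u) (t + 1)} ↔
        Good c v (extendZero u) t ∧ |⟪v t, walk c v (extendZero u) t⟫| ≤ c := fun x => by
      rw [Set.mem_ofPred_eq, extendZero_update, good_succ_update]
    by_cases hg : Good c v (extendZero u) t ∧ |⟪v t, walk c v (extendZero u) t⟫| ≤ c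
    · rw [Set.indicator_of_mem (show u ∈ {u | Good c v (extendZero u) t} from hg.1)]
      simp only [Set.indicator_of_mem ((hmem _).2 hg), extendZero_update, walk,
        Function.update_self, walk_update le_rfl]
      exact lintegral_step_le hconv h0 (by linarith) hg.2
    · simp [Set.indicator_of_notMem (fun h => hg ((hmem _).1 h))]

end Walk

section TailBounds

lemma _root_.ConvexOn.exp {V : Type*} [AddCommGroup V] [Module ℝ V] {f : V → ℝ}
    (hf : ConvexOn ℝ Set.univ f) : ConvexOn ℝ Set.univ fun x => rexp (f x) := by
  refine ⟨convex_univ, fun x hx y hy a b ha hb hab => ?_⟩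
  exact (Real.exp_le_exp.2 (hf.2 hx hy ha hb hab)).trans
    (convexOn_exp.2 (Set.mem_univ _) (Set.mem_univ _) ha hb hab)

variable {E : Type*} [NormedAddCommGroup E] [InnerProductSpace ℝ E] [FiniteDimensional ℝ E]
  [MeasurableSpace E] [BorelSpace E]

lemma lintegral_exp_inner_stdGaussian (θ : E) :
    ∫⁻ x, ENNReal.ofReal (rexp ⟪θ, x⟫) ∂(stdGaussian E) = ENNReal.ofReal (rexp (‖θ‖ ^ 2 / 2)) := by
  have h1 := IsGaussian.map_eq_gaussianReal (μ := stdGaussian E) (innerSL ℝ θ)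
  rw [integral_strongDual_stdGaussian, variance_dual_stdGaussian, innerSL_apply_norm] at h1
  set w : NNReal := (‖θ‖ ^ 2).toNNReal with hw
  have h2 : ∫⁻ x, ENNReal.ofReal (rexp x) ∂(gaussianReal 0 w) =
      ENNReal.ofReal (rexp (‖θ‖ ^ 2 / 2)) := by
    have hint : Integrable (fun x => rexp x) (gaussianReal 0 w) := by
      simpa using integrable_exp_mul_gaussianReal (μ := 0) (v := w) 1
    rw [← ofReal_integral_eq_lintegral_ofReal hint (ae_of_all _ fun x => (Real.exp_pos x).le)]
    have h3 := congrFun (mgf_id_gaussianReal (μ := 0) (v := w)) 1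
    simp only [mgf, id, one_mul] at h3
    rw [h3, hw, Real.coe_toNNReal _ (by positivity)]
    simp
  rw [← h2, ← h1, lintegral_map (by fun_prop) (by fun_prop)]
  rfl

/-- Markov's inequality for the walk, via Gaussian domination. -/
lemma measure_good_and_le {T : ℕ} {c : ℝ} (hc : 1 ≤ c) {v : ℕ → E} (hv : ∀ s, ‖v s‖ ≤ 1) {L : ℝ}
    (hL : L = 4 * c / absMean ^ 2) {t : ℕ} (ht : t ≤ T) {φ : E → ℝ}
    (hconv : ConvexOn ℝ Set.univ φ) (hcont : Continuous φ) (h0 : ∀ x, 0 ≤ φ x) :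
    (Measure.pi fun _ : Fin T => volume.restrict (Set.Icc (0 : ℝ) 1))
        {u | Good c v (extendZero u) t ∧ 1 ≤ φ (walk c v (extendZero u) t)} ≤
      ∫⁻ x, ENNReal.ofReal (φ (√L • x)) ∂(stdGaussian E) := by
  refine le_trans ?_ (lintegral_walk_le hc hv hL ht hconv hcont h0)
  have mw : Measurable fun u : Fin T → ℝ => walk c v (extendZero u) t :=
    measurable_walk c t (fun _ => measurable_const) measurable_extendZero
  have mg : MeasurableSet {u : Fin T → ℝ | Good c v (extendZero u) t} :=
    measurableSet_good c t (fun _ => measurable_const) measurable_extendZero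
  have mS : MeasurableSet {u : Fin T → ℝ | Good c v (extendZero u) t ∧
      1 ≤ φ (walk c v (extendZero u) t)} :=
    mg.inter (measurableSet_le measurable_const (hcont.measurable.comp mw))
  rw [← lintegral_indicator_one mS]
  refine lintegral_mono fun u => ?_
  by_cases hu : Good c v (extendZero u) t ∧ 1 ≤ φ (walk c v (extendZero u) t)
  · rw [Set.indicator_of_mem (show u ∈ {u : Fin T → ℝ | Good c v (extendZero u) t ∧
      1 ≤ φ (walk c v (extendZero u) t)} from hu),
      Set.indicator_of_mem (show u ∈ {u : Fin T → ℝ | Good c v (extendZero u) t} from hu.1)]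
    exact ENNReal.one_le_ofReal.2 hu.2
  · rw [Set.indicator_of_notMem (show u ∉ {u : Fin T → ℝ | Good c v (extendZero u) t ∧
      1 ≤ φ (walk c v (extendZero u) t)} from hu)]
    exact bot_le

/-- The walk leaves the band `|⟪v t, ·⟫| ≤ c` at a given time with small probability. -/
lemma measure_good_and_lt_abs_inner_le {T : ℕ} {c : ℝ} (hc : 1 ≤ c) {v : ℕ → E}
    (hv : ∀ s, ‖v s‖ ≤ 1) {t : ℕ} (ht : t ≤ T) :
    (Measure.pi fun _ : Fin T => volume.restrict (Set.Icc (0 : ℝ) 1))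
        {u | Good c v (extendZero u) t ∧ c < |⟪v t, walk c v (extendZero u) t⟫|} ≤
      ENNReal.ofReal (2 * rexp (-(c * absMean ^ 2 / 8))) := by
  have ha := absMean_pos
  set L : ℝ := 4 * c / absMean ^ 2 with hL
  have hL0 : 0 ≤ L := by positivity
  set η : ℝ := absMean ^ 2 / 4 with hη
  have hη0 : 0 < η := by positivity
  have key : ∀ θ : E, ‖θ‖ ≤ 1 →
      (Measure.pi fun _ : Fin T => volume.restrict (Set.Icc (0 : ℝ) 1))
        {u | Good c v (extendZero u) t ∧ 1 ≤ rexp (η * (⟪θ, walk c v (extendZero u) t⟫ - c))} ≤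
      ENNReal.ofReal (rexp (-(c * absMean ^ 2 / 8))) := by
    intro θ hθ
    refine (measure_good_and_le (φ := fun w => rexp (η * (⟪θ, w⟫ - c))) hc hv hL ht ?_
      (by fun_prop) (fun x => (Real.exp_pos _).le)).trans ?_
    · have h1 : ConvexOn ℝ Set.univ fun w : E => η * (⟪θ, w⟫ - c) := by
        refine ⟨convex_univ, fun x _ y _ a b _ _ hab => le_of_eq ?_⟩
        simp only [inner_add_right, real_inner_smul_right, smul_eq_mul]
        obtain rfl : b = 1 - a := by linarith
        ring
      exact h1.exp
    · have h2 : ∀ x : E, ENNReal.ofReal (rexp (η * (⟪θ, √L • x⟫ - c))) =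
          ENNReal.ofReal (rexp (-(η * c))) * ENNReal.ofReal (rexp ⟪(η * √L) • θ, x⟫) := by
        intro x
        rw [← ENNReal.ofReal_mul (by positivity), ← Real.exp_add, real_inner_smul_left,
          real_inner_smul_right]
        ring_nf
      simp_rw [h2]
      rw [lintegral_const_mul _ (by fun_prop), lintegral_exp_inner_stdGaussian,
        ← ENNReal.ofReal_mul (by positivity), ← Real.exp_add]
      refine ENNReal.ofReal_le_ofReal (Real.exp_le_exp.2 ?_)
      have h3 : ‖(η * √L) • θ‖ ^ 2 ≤ η ^ 2 * L := by
        rw [norm_smul, Real.norm_eq_abs, mul_pow, sq_abs, mul_pow, Real.sq_sqrt hL0]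
        have : ‖θ‖ ^ 2 ≤ 1 := pow_le_one₀ (norm_nonneg _) hθ
        exact mul_le_of_le_one_right (by positivity) this
      have h4 : η ^ 2 * L = c * absMean ^ 2 / 4 := by
        rw [hη, hL]; field_simp
      rw [h4] at h3
      rw [hη]
      linarith
  calc _ ≤ (Measure.pi fun _ : Fin T => volume.restrict (Set.Icc (0 : ℝ) 1))
        ({u | Good c v (extendZero u) t ∧ 1 ≤ rexp (η * (⟪v t, walk c v (extendZero u) t⟫ - c))} ∪
         {u | Good c v (extendZero u) t ∧
          1 ≤ rexp (η * (⟪-v t, walk c v (extendZero u) t⟫ - c))}) := by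
        refine measure_mono ?_
        rintro u ⟨hg, hu⟩
        rcases lt_abs.1 hu with h | h
        · exact Or.inl ⟨hg, Real.one_le_exp (by nlinarith)⟩
        · refine Or.inr ⟨hg, Real.one_le_exp ?_⟩
          rw [inner_neg_left]; nlinarith
    _ ≤ ENNReal.ofReal (rexp (-(c * absMean ^ 2 / 8))) +
          ENNReal.ofReal (rexp (-(c * absMean ^ 2 / 8))) :=
        (measure_union_le _ _).trans (add_le_add (key _ (hv t))
          (key _ (by rw [norm_neg]; exact hv t)))
    _ = _ := by
        rw [← ENNReal.ofReal_add (by positivity) (by positivity)]; ring_nf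

lemma measure_good_and_lt_seminorm_le {T : ℕ} {c : ℝ} (hc : 1 ≤ c) {v : ℕ → E}
    (hv : ∀ s, ‖v s‖ ≤ 1) {t : ℕ} (ht : t ≤ T) {L : ℝ} (hL : L = 4 * c / absMean ^ 2)
    (s : Seminorm ℝ E) (hs : Continuous s) {M : ℝ}
    (hM : ∫⁻ x, ENNReal.ofReal (rexp (s x)) ∂(stdGaussian E) ≤ ENNReal.ofReal M) (l : ℝ) :
    (Measure.pi fun _ : Fin T => volume.restrict (Set.Icc (0 : ℝ) 1))
        {u | Good c v (extendZero u) t ∧ √L * l < s (walk c v (extendZero u) t)} ≤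
      ENNReal.ofReal (rexp (-l) * M) := by
  have ha := absMean_pos
  have hL0 : 0 < √L := by rw [hL]; positivity
  have hφ : ConvexOn ℝ Set.univ fun w => rexp ((√L)⁻¹ * s w - l) := by
    have h1 : ConvexOn ℝ Set.univ fun w : E => (√L)⁻¹ * s w - l := by
      have := (s.convexOn.smul (c := (√L)⁻¹) (by positivity)).add_const (-l)
      simpa [sub_eq_add_neg, Pi.add_def] using this
    exact h1.exp
  calc _ ≤ (Measure.pi fun _ : Fin T => volume.restrict (Set.Icc (0 : ℝ) 1))
        {u | Good c v (extendZero u) t ∧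
          1 ≤ rexp ((√L)⁻¹ * s (walk c v (extendZero u) t) - l)} := by
        refine measure_mono ?_
        rintro u ⟨hg, hu⟩
        refine ⟨hg, Real.one_le_exp ?_⟩
        rw [mul_comm, ← lt_div_iff₀ hL0] at hu
        rw [inv_mul_eq_div]
        linarith
    _ ≤ ∫⁻ x, ENNReal.ofReal (rexp ((√L)⁻¹ * s (√L • x) - l)) ∂(stdGaussian E) :=
        measure_good_and_le hc hv hL ht hφ (by fun_prop) fun x => (Real.exp_pos _).le
    _ = ENNReal.ofReal (rexp (-l)) * ∫⁻ x, ENNReal.ofReal (rexp (s x)) ∂(stdGaussian E) := by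
        rw [← lintegral_const_mul _ (by fun_prop)]
        refine lintegral_congr fun x => ?_
        rw [← ENNReal.ofReal_mul (by positivity), ← Real.exp_add, map_smul_eq_mul,
          Real.norm_of_nonneg hL0.le, inv_mul_cancel_left₀ hL0.ne']
        ring_nf
    _ ≤ _ := by
        rw [ENNReal.ofReal_mul (by positivity)]
        gcongr

end TailBounds

/-- The threshold of the self-balancing walk per unit of logarithm. -/
noncomputable def thresholdRate : ℝ := 16 / absMean ^ 2 + 1

/-- The self-balancing walk stays, with high probability, in a small multiple of the unit ball of
any norm whose unit ball has Gaussian measure at least `1/2`. -/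
theorem exists_measure_walk_le : ∃ D M : ℝ, 0 < D ∧ 0 < M ∧
    ∀ {E : Type} [NormedAddCommGroup E] [InnerProductSpace ℝ E] [FiniteDimensional ℝ E]
      [MeasurableSpace E] [BorelSpace E] (s : Seminorm ℝ E), (∀ x, s x = 0 → x = 0) →
      Continuous s → 2⁻¹ ≤ stdGaussian E {x | s x ≤ 1} →
      ∀ {T : ℕ}, 0 < T → ∀ {l : ℝ}, 1 ≤ l → Real.log T ≤ l →
      ∀ {v : ℕ → E}, (∀ s, ‖v s‖ ≤ 1) →
      (Measure.pi fun _ : Fin T => volume.restrict (Set.Icc (0 : ℝ) 1))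
        {u | ∃ t ≤ T, D * l ^ 2 < s (walk (thresholdRate * l) v (extendZero u) t)} ≤
      ENNReal.ofReal (M / T) := by
  obtain ⟨M, hM, h⟩ := exists_lintegral_exp_seminorm_le
  have ha := absMean_pos
  have hr : 0 < thresholdRate := by unfold thresholdRate; positivity
  refine ⟨√(4 * thresholdRate / absMean ^ 2) * 2, 2 + 2 * M, by positivity, by positivity, ?_⟩
  intro E _ _ _ _ _ s hs0 hs hK T hT l hl hTl v hv
  have hl0 : 0 < l := by linarith
  set c : ℝ := thresholdRate * l with hc
  have hc1 : 1 ≤ c := by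
    have : 1 ≤ thresholdRate := by
      unfold thresholdRate
      have : 0 < 16 / absMean ^ 2 := by positivity
      linarith
    nlinarith
  have hT0 : (0 : ℝ) < T := by exact_mod_cast hT
  have hT1 : (1 : ℝ) ≤ T := by exact_mod_cast hT
  have hexp : rexp (-(2 * l)) ≤ 1 / (T : ℝ) ^ 2 := by
    have h1 : rexp (-(2 * l)) ≤ rexp (-(2 * Real.log T)) := Real.exp_le_exp.2 (by linarith)
    refine h1.trans (le_of_eq ?_)
    rw [Real.exp_neg, two_mul, Real.exp_add, Real.exp_log hT0, one_div, sq]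
  set L : ℝ := 4 * c / absMean ^ 2 with hL
  have hsL : √L ≤ √(4 * thresholdRate / absMean ^ 2) * l := by
    rw [Real.sqrt_le_left (by positivity), mul_pow, Real.sq_sqrt (by positivity), hL, hc]
    rw [div_mul_eq_mul_div, div_le_div_iff_of_pos_right (by positivity)]
    nlinarith [mul_pos hr hl0]
  set μ := Measure.pi fun _ : Fin T => volume.restrict (Set.Icc (0 : ℝ) 1)
  have hfail : ∀ t ≤ T, μ {u | Good c v (extendZero u) t ∧
      c < |⟪v t, walk c v (extendZero u) t⟫|} ≤ ENNReal.ofReal (2 / (T : ℝ) ^ 2) := by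
    intro t ht
    refine (measure_good_and_lt_abs_inner_le hc1 hv ht).trans (ENNReal.ofReal_le_ofReal ?_)
    have h1 : rexp (-(c * absMean ^ 2 / 8)) ≤ rexp (-(2 * l)) := by
      refine Real.exp_le_exp.2 (neg_le_neg ?_)
      have : c * absMean ^ 2 / 8 = 2 * l + l * absMean ^ 2 / 8 := by
        rw [hc, thresholdRate]; field_simp; norm_num
      rw [this]
      have : 0 < l * absMean ^ 2 / 8 := by positivity
      linarith
    calc _ ≤ 2 * (1 / (T : ℝ) ^ 2) := by gcongr; exact h1.trans hexp
      _ = _ := by ring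
  have hbig : ∀ t ≤ T, μ {u | Good c v (extendZero u) t ∧
      √L * (2 * l) < s (walk c v (extendZero u) t)} ≤ ENNReal.ofReal (M / (T : ℝ) ^ 2) := by
    intro t ht
    refine (measure_good_and_lt_seminorm_le hc1 hv ht hL s hs (h s hs0 hK) (2 * l)).trans
      (ENNReal.ofReal_le_ofReal ?_)
    calc _ ≤ 1 / (T : ℝ) ^ 2 * M := by gcongr
      _ = _ := by ring
  calc μ {u | ∃ t ≤ T, √(4 * thresholdRate / absMean ^ 2) * 2 * l ^ 2 <
          s (walk c v (extendZero u) t)}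
      ≤ μ ((⋃ t ∈ Finset.range T, {u | Good c v (extendZero u) t ∧
          c < |⟪v t, walk c v (extendZero u) t⟫|}) ∪
          (⋃ t ∈ Finset.range (T + 1), {u | Good c v (extendZero u) t ∧
            √L * (2 * l) < s (walk c v (extendZero u) t)})) := by
        refine measure_mono ?_
        rintro u ⟨t, ht, hu⟩
        have hu' : √L * (2 * l) < s (walk c v (extendZero u) t) := by
          refine lt_of_le_of_lt ?_ hu
          calc √L * (2 * l) ≤ (√(4 * thresholdRate / absMean ^ 2) * l) * (2 * l) := by gcongr
            _ = _ := by ring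
        by_cases hg : Good c v (extendZero u) t
        · exact Or.inr (Set.mem_biUnion (Finset.mem_coe.2 (Finset.mem_range.2
            (Nat.lt_succ_of_le ht))) ⟨hg, hu'⟩)
        · have hex : ∃ r, ¬ Good c v (extendZero u) r := ⟨t, hg⟩
          classical
          have hne : Nat.find hex ≠ 0 := by
            intro h0
            have := Nat.find_spec hex
            rw [h0] at this
            exact this fun s hs => absurd hs (by omega)
          obtain ⟨r, hr⟩ := Nat.exists_eq_succ_of_ne_zero hne
          have hrt : r + 1 ≤ t := by
            have := Nat.find_min' hex hg
            omega
          have hgr : Good c v (extendZero u) r := by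
            have := Nat.find_min hex (m := r) (by omega)
            simpa using this
          have hngr : ¬ Good c v (extendZero u) (r + 1) := by
            have := Nat.find_spec hex
            rwa [hr] at this
          rw [good_succ] at hngr
          refine Or.inl (Set.mem_biUnion (Finset.mem_coe.2 (Finset.mem_range.2
            (show r < T by omega))) ?_)
          refine ⟨hgr, ?_⟩
          by_contra! hcon
          exact hngr ⟨hgr, hcon⟩
    _ ≤ (∑ t ∈ Finset.range T, ENNReal.ofReal (2 / (T : ℝ) ^ 2)) +
          ∑ t ∈ Finset.range (T + 1), ENNReal.ofReal (M / (T : ℝ) ^ 2) := by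
        refine (measure_union_le _ _).trans (add_le_add ?_ ?_)
        · refine (measure_biUnion_finset_le _ _).trans (Finset.sum_le_sum fun t ht => hfail t ?_)
          exact (Finset.mem_range.1 ht).le
        · refine (measure_biUnion_finset_le _ _).trans (Finset.sum_le_sum fun t ht => hbig t ?_)
          exact Nat.lt_succ_iff.1 (Finset.mem_range.1 ht)
    _ ≤ ENNReal.ofReal ((2 + 2 * M) / T) := by
        simp only [Finset.sum_const, Finset.card_range, nsmul_eq_mul]
        rw [← ENNReal.ofReal_natCast, ← ENNReal.ofReal_natCast,
          ← ENNReal.ofReal_mul (by positivity), ← ENNReal.ofReal_mul (by positivity),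
          ← ENNReal.ofReal_add (by positivity) (by positivity)]
        refine ENNReal.ofReal_le_ofReal ?_
        push_cast
        have h1 : ((2 + 2 * M) / T : ℝ) = (2 * T + 2 * M * T) / (T : ℝ) ^ 2 := by
          field_simp
        have h2 : (T : ℝ) * (2 / (T : ℝ) ^ 2) + (T + 1) * (M / (T : ℝ) ^ 2) =
            (2 * T + (T + 1) * M) / (T : ℝ) ^ 2 := by ring
        rw [h1, h2]
        rw [div_le_div_iff_of_pos_right (by positivity)]
        nlinarith

/-- The product of standard Gaussian measures has the usual density. -/
lemma withDensity_eq_pi_gaussianReal (n : ℕ) :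
    (volume.withDensity fun x : Fin n → ℝ =>
      ENNReal.ofReal ((2 * Real.pi) ^ (-(n : ℝ) / 2) * Real.exp (-(∑ i, x i ^ 2) / 2))) =
      Measure.pi fun _ : Fin n => gaussianReal 0 1 := by
  have hdens : ∀ x : Fin n → ℝ, (2 * Real.pi) ^ (-(n : ℝ) / 2) * Real.exp (-(∑ i, x i ^ 2) / 2) =
      ∏ i, gaussianPDFReal 0 1 (x i) := by
    intro x
    simp only [gaussianPDFReal, Finset.prod_mul_distrib, Finset.prod_const, Finset.card_univ,
      Fintype.card_fin, ← Real.exp_sum, NNReal.coe_one, mul_one, sub_zero]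
    congr 1
    · rw [Real.sqrt_eq_rpow, ← Real.rpow_neg (by positivity), ← Real.rpow_natCast,
        ← Real.rpow_mul (by positivity)]
      congr 1; ring
    · rw [← Finset.sum_div, Finset.sum_neg_distrib]
  symm
  refine Measure.pi_eq fun s hs => ?_
  rw [withDensity_apply _ (MeasurableSet.univ_pi hs)]
  simp_rw [hdens]
  have hint : ∀ i, Integrable (gaussianPDFReal 0 1) (volume.restrict (s i)) := fun i =>
    (integrable_gaussianPDFReal 0 1).restrict
  have hnn : ∀ i, 0 ≤ ∫ x in s i, gaussianPDFReal 0 1 x := fun i =>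
    integral_nonneg fun x => gaussianPDFReal_nonneg _ _ _
  simp_rw [gaussianReal_apply_eq_integral 0 one_ne_zero]
  rw [← ENNReal.ofReal_prod_of_nonneg fun i _ => hnn i, volume_pi, Measure.restrict_pi_pi,
    ← ofReal_integral_eq_lintegral_ofReal (Integrable.fintype_prod hint)
      (ae_of_all _ fun x => Finset.prod_nonneg fun i _ => gaussianPDFReal_nonneg _ _ _),
    integral_fintype_prod_eq_prod]

lemma mem_nhds_zero_of_symmetric {V : Type*} [NormedAddCommGroup V] [NormedSpace ℝ V] {K : Set V}
    (hconv : Convex ℝ K) (hint : (interior K).Nonempty) (hsymm : K = -K) : K ∈ nhds (0 : V) := by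
  obtain ⟨x, hx⟩ := hint
  have hx' : -x ∈ interior K := by
    have h := (Homeomorph.neg V).preimage_interior K
    simp only [Homeomorph.coe_neg, Set.neg_preimage] at h
    rw [← hsymm] at h
    rw [← Set.mem_neg, h]
    exact hx
  rw [← mem_interior_iff_mem_nhds]
  have := hconv.interior hx hx' (a := 1 / 2) (b := 1 / 2) (by norm_num) (by norm_num) (by norm_num)
  simpa using this

/-- The Minkowski gauge of a symmetric convex body, as a seminorm on Euclidean space. -/
lemma exists_seminorm {ι : Type} [Fintype ι] {K : Set (ι → ℝ)} (hK : IsCompact K)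
    (hconv : Convex ℝ K) (hint : (interior K).Nonempty) (hsymm : K = -K) :
    ∃ s : Seminorm ℝ (EuclideanSpace ℝ ι), (∀ x, s x = 0 → x = 0) ∧
      Continuous s ∧ (∀ x, s x ≤ 1 ↔ WithLp.ofLp x ∈ K) ∧
      ∀ {r : ℝ}, 0 < r → ∀ x, s x ≤ r → WithLp.ofLp x ∈ r • K := by
  have h0 : K ∈ nhds 0 := mem_nhds_zero_of_symmetric hconv hint hsymm
  have habs : Absorbent ℝ K := absorbent_nhds_zero h0
  have hbal : Balanced ℝ K := by
    rw [balanced_iff_neg_mem hconv]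
    intro x hx
    rw [hsymm] at hx
    exact hx
  set s : Seminorm ℝ (EuclideanSpace ℝ ι) :=
    (gaugeSeminorm hbal hconv habs).comp (WithLp.linearEquiv 2 ℝ (ι → ℝ)).toLinearMap with hs
  have hsg : ∀ x, s x = gauge K (WithLp.ofLp x) := fun x => rfl
  have h1 : ∀ x, s x ≤ 1 ↔ WithLp.ofLp x ∈ K := by
    intro x
    rw [hsg, gauge_le_one_iff_mem_closure hconv h0, hK.isClosed.closure_eq]
  refine ⟨s, fun x hx => ?_, ?_, h1, ?_⟩
  · rw [hsg, gauge_eq_zero habs (hK.isVonNBounded ℝ)] at hx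
    simpa using hx
  · exact (continuous_gauge hconv h0).comp (PiLp.continuous_ofLp 2 _)
  · intro r hr x hx
    rw [Set.mem_smul_set_iff_inv_smul_mem₀ hr.ne', ← WithLp.ofLp_smul, ← h1, map_smul_eq_mul,
      Real.norm_of_nonneg (by positivity)]
    rw [inv_mul_le_iff₀ hr]
    simpa using hx

section Signs

variable {E : Type*} [NormedAddCommGroup E] [InnerProductSpace ℝ E]

lemma walk_eq_sum (c : ℝ) (v : ℕ → E) (u : ℕ → ℝ) (t : ℕ) :
    walk c v u t = ∑ s ∈ Finset.range t, balancingSign c ⟪v s, walk c v u s⟫ (u s) • v s := by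
  induction t with
  | zero => rfl
  | succ t ih => rw [Finset.sum_range_succ, ← ih, walk]

lemma measurable_balancingSign (c : ℝ) :
    Measurable fun q : ℝ × ℝ => balancingSign c q.1 q.2 :=
  Measurable.ite (measurableSet_le (by fun_prop) (by fun_prop)) measurable_const measurable_const

end Signs

end OnlineBanaszczyk

open OnlineBanaszczyk ProbabilityTheory in
/-- **Online Banaszczyk setting** (Theorem 1.4).  For every `c > 0` there is `C > 0` such that
for all `n, T ≥ 2`, every symmetric convex body `K ⊆ ℝ^n` with standard Gaussian measure at
least `1/2`, and every probability distribution `p` supported on the closed Euclidean unit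
ball having sub-exponential tails with constant `c`, there is an online signing algorithm such
that with probability at least `1 - C/T` the discrepancy vectors satisfy
`d_t ∈ C (log (nT))^5 • K` for all `t`. -/
theorem online_banaszczyk :
    ∀ c : ℝ, 0 < c →
    ∃ C : ℝ, 0 < C ∧
      ∀ (n T : ℕ), 2 ≤ n → 2 ≤ T →
      ∀ K : Set (Fin n → ℝ),
        IsCompact K → Convex ℝ K → (interior K).Nonempty → K = -K →
        -- standard Gaussian measure of `K` is at least 1/2
        (volume.withDensity fun x : Fin n → ℝ =>
            ENNReal.ofReal ((2 * Real.pi) ^ (-(n : ℝ) / 2) * Real.exp (-(∑ i, x i ^ 2) / 2))) K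
          ≥ 1 / 2 →
      ∀ (p : Measure (Fin n → ℝ)) [IsProbabilityMeasure p],
      (∀ᵐ v ∂p, Real.sqrt (∑ i, v i ^ 2) ≤ 1) →
      -- sub-exponential tails with constant `c`
      (∀ θ : Fin n → ℝ, Real.sqrt (∑ i, θ i ^ 2) = 1 → ∀ r : ℝ, 0 < r →
        p {v | r * Real.sqrt (∫ w, (∑ i, w i * θ i - ∫ w', ∑ i, w' i * θ i ∂p) ^ 2 ∂p)
              ≤ |∑ i, v i * θ i - ∫ w', ∑ i, w' i * θ i ∂p|}
          ≤ ENNReal.ofReal (2 * Real.exp (-c * r))) →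
      ∃ χ : (t : Fin T) → (Fin (t.1 + 1) → (Fin n → ℝ)) → (Fin (t.1 + 1) → ℝ) → ℝ,
        (∀ t, Measurable fun q : (Fin (t.1 + 1) → (Fin n → ℝ)) × (Fin (t.1 + 1) → ℝ) =>
            χ t q.1 q.2) ∧
        (∀ t v u, χ t v u = 1 ∨ χ t v u = -1) ∧
        ((Measure.pi fun _ : Fin T => p).prod
            (Measure.pi fun _ : Fin T => volume.restrict (Set.Icc (0:ℝ) 1)))
          {ω : (Fin T → (Fin n → ℝ)) × (Fin T → ℝ) |
            ∀ t : Fin T,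
              (∑ s ∈ Finset.Iic t,
                  χ s (fun j => ω.1 (Fin.castLE s.isLt j)) (fun j => ω.2 (Fin.castLE s.isLt j))
                    • ω.1 s) ∈ (C * Real.log ((n : ℝ) * T) ^ 5) • K } ≥
          ENNReal.ofReal (1 - C / T) := by
  obtain ⟨D, M, hD, hM, hwalk⟩ := exists_measure_walk_le
  intro _ _
  refine ⟨D + M, by positivity, ?_⟩
  intro n T hn hT K hK hconv hint hsymm hγ p _ hp _
  obtain ⟨s, hs0, hs, hs1, hsr⟩ := exists_seminorm hK hconv hint hsymm
  set l : ℝ := Real.log ((n : ℝ) * T) with hl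
  have hn' : (2 : ℝ) ≤ n := by exact_mod_cast hn
  have hT' : (2 : ℝ) ≤ T := by exact_mod_cast hT
  have hl1 : 1 ≤ l := by
    have h1 : Real.log (2 * 2) ≤ l := Real.log_le_log (by norm_num) (by nlinarith)
    rw [Real.log_mul (by norm_num) (by norm_num)] at h1
    linarith [Real.log_two_gt_d9]
  have hTl : Real.log T ≤ l := Real.log_le_log (by linarith) (by nlinarith)
  have hγ' : 2⁻¹ ≤ stdGaussian (EuclideanSpace ℝ (Fin n)) {x | s x ≤ 1} := by
    rw [← map_pi_eq_stdGaussian, Measure.map_apply (by fun_prop)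
      (measurableSet_le hs.measurable measurable_const), ← withDensity_eq_pi_gaussianReal]
    rw [one_div] at hγ
    refine hγ.trans (measure_mono fun x hx => ?_)
    exact (hs1 _).2 hx
  set c : ℝ := thresholdRate * l
  have mlp : Measurable (WithLp.toLp 2 : (Fin n → ℝ) → EuclideanSpace ℝ (Fin n)) := by fun_prop
  let lift {m : ℕ} (v : Fin m → Fin n → ℝ) : ℕ → EuclideanSpace ℝ (Fin n) :=
    extendZero fun j => WithLp.toLp 2 (v j)
  have mext : ∀ {m : ℕ} (k : ℕ), Measurable fun v : Fin m → Fin n → ℝ => lift v k := fun k =>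
    (measurable_extendZero k).comp (measurable_pi_lambda _ fun j =>
      mlp.comp (measurable_pi_apply j))
  refine ⟨fun t v u => balancingSign c (inner ℝ (lift v t) (walk c (lift v) (extendZero u) t))
    (extendZero u t), fun t => ?_, fun _ _ _ => balancingSign_eq _ _ _, ?_⟩
  · have m1 : Measurable fun q : (Fin (t.1 + 1) → (Fin n → ℝ)) × (Fin (t.1 + 1) → ℝ) =>
        walk c (lift q.1) (extendZero q.2) t :=
      measurable_walk c t (fun k => (mext k).comp measurable_fst)
        (fun k => (measurable_extendZero k).comp measurable_snd)
    exact (measurable_balancingSign c).comp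
      (((((mext t).comp measurable_fst)).inner m1).prodMk
        ((measurable_extendZero t).comp measurable_snd))
  set μ := Measure.pi fun _ : Fin T => volume.restrict (Set.Icc (0 : ℝ) 1) with hμ
  have : IsProbabilityMeasure (volume.restrict (Set.Icc (0 : ℝ) 1)) := ⟨by simp⟩
  set B : Set ((Fin T → (Fin n → ℝ)) × (Fin T → ℝ)) :=
    {ω | ∃ t ≤ T, D * l ^ 2 < s (walk c (lift ω.1) (extendZero ω.2) t)} with hB
  have mB : MeasurableSet B := by
    have : B = ⋃ t ∈ Set.Iic T,
        {ω | D * l ^ 2 < s (walk c (lift ω.1) (extendZero ω.2) t)} := by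
      ext ω; simp [hB]
    rw [this]
    refine MeasurableSet.biUnion (Set.to_countable _) fun t _ => ?_
    exact measurableSet_lt measurable_const (hs.measurable.comp
      (measurable_walk c t (fun k => (mext k).comp measurable_fst)
        (fun k => (measurable_extendZero k).comp measurable_snd)))
  have hBle : ((Measure.pi fun _ : Fin T => p).prod μ) B ≤ ENNReal.ofReal (M / T) := by
    rw [Measure.prod_apply mB]
    have hae : ∀ᵐ v ∂(Measure.pi fun _ : Fin T => p), ∀ j, Real.sqrt (∑ i, v j i ^ 2) ≤ 1 :=
      ae_all_iff.2 fun j =>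
        (measurePreserving_eval (fun _ : Fin T => p) j).quasiMeasurePreserving.ae hp
    calc _ ≤ ∫⁻ _, ENNReal.ofReal (M / T) ∂(Measure.pi fun _ : Fin T => p) := by
          refine lintegral_mono_ae ?_
          filter_upwards [hae] with v hv
          refine hwalk s hs0 hs hγ' (by omega) hl1 hTl (v := lift v) fun k => ?_
          simp only [lift, extendZero]
          split_ifs with hk
          · rw [EuclideanSpace.norm_eq]
            simpa using hv ⟨k, hk⟩
          · simp
      _ = _ := by simp
  have hsub : Bᶜ ⊆ {ω : (Fin T → (Fin n → ℝ)) × (Fin T → ℝ) | ∀ t : Fin T,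
      (∑ s ∈ Finset.Iic t,
        (fun (t : Fin T) (v : Fin (t.1 + 1) → (Fin n → ℝ)) (u : Fin (t.1 + 1) → ℝ) =>
          balancingSign c (inner ℝ (lift v t) (walk c (lift v) (extendZero u) t))
            (extendZero u t)) s
          (fun j => ω.1 (Fin.castLE s.isLt j)) (fun j => ω.2 (Fin.castLE s.isLt j)) • ω.1 s) ∈
        ((D + M) * l ^ 5) • K} := by
    intro ω hω t
    have hx : s (walk c (lift ω.1) (extendZero ω.2) (t + 1)) ≤ (D + M) * l ^ 5 := by
      have h1 : s (walk c (lift ω.1) (extendZero ω.2) (t + 1)) ≤ D * l ^ 2 := by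
        by_contra! hlt
        exact hω ⟨t + 1, t.isLt, hlt⟩
      refine h1.trans ?_
      gcongr
      · linarith
      · norm_num
    have hmem := hsr (by positivity) _ hx
    convert hmem using 1
    rw [walk_eq_sum, ← Nat.Iio_eq_range, Finset.Iio_add_one_eq_Iic,
      ← Fin.map_valEmbedding_Iic, Finset.sum_map, WithLp.ofLp_sum]
    refine Finset.sum_congr rfl fun r _ => ?_
    have hextv : ∀ k ≤ (r : ℕ), lift (fun j => ω.1 (Fin.castLE r.isLt j)) k = lift ω.1 k := by
      intro k hk
      simp only [lift, extendZero, dif_pos (show k < (r : ℕ) + 1 by omega),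
        dif_pos (show k < T by omega)]
      rfl
    have hextu : ∀ k ≤ (r : ℕ),
        extendZero (fun j => ω.2 (Fin.castLE r.isLt j)) k = extendZero ω.2 k := by
      intro k hk
      simp only [extendZero, dif_pos (show k < (r : ℕ) + 1 by omega),
        dif_pos (show k < T by omega)]
      rfl
    simp only [Fin.valEmbedding_apply, WithLp.ofLp_smul]
    rw [hextv r le_rfl, hextu r le_rfl, walk_congr (fun k hk => hextv k hk.le)
      (fun k hk => hextu k hk.le)]
    congr 1
    simp [lift, extendZero]
  refine le_trans ?_ (measure_mono hsub)
  rw [prob_compl_eq_one_sub mB]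
  calc ENNReal.ofReal (1 - (D + M) / T) ≤ ENNReal.ofReal (1 - M / T) := by
        refine ENNReal.ofReal_le_ofReal ?_
        gcongr
        linarith
    _ = 1 - ENNReal.ofReal (M / T) := by
        rw [ENNReal.ofReal_sub _ (by positivity), ENNReal.ofReal_one]
    _ ≤ _ := tsub_le_tsub_left hBle _
end
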